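/- arXiv:1811.01421 — 11 statements merged into one kernel-verified Lean document; each statement's English description precedes it below -/
import Mathlib

section
/- For every n-vertex clique σ with status function δ, the subdivision χ(σ,δ) is a connected graph. -/
set_option linter.dupNamespace false

namespace EBP

/-- A graph on a vertex universe `V`: a vertex set together with a symmetric
adjacency relation supported on the vertex set. -/
structure PGraph (V : Type) where
  verts : Set V
  Adj : V → V → Prop
  symm : ∀ u v, Adj u v → Adj v u
  adj_mem : ∀ u v, Adj u v → u ∈ verts ∧ v ∈ verts

variable {V O : Type}

/-- `σ` is an `n`-vertex clique of `G`: `n` pairwise adjacent vertices with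
pairwise distinct identifiers. -/
def IsNClique (n : ℕ) (G : PGraph V) (idv : V → Fin n) (σ : Set V) : Prop :=
  σ ⊆ G.verts ∧ σ.Finite ∧ σ.ncard = n ∧
    (∀ u ∈ σ, ∀ v ∈ σ, u ≠ v → G.Adj u v) ∧ Set.InjOn idv σ

/-- `G` is a union of `n`-vertex cliques: every vertex and every edge is
contained in some `n`-vertex clique. -/
def IsCliqueUnionGraph (n : ℕ) (G : PGraph V) (idv : V → Fin n) : Prop :=
  (∀ v ∈ G.verts, ∃ σ, IsNClique n G idv σ ∧ v ∈ σ) ∧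
    (∀ u v, G.Adj u v → ∃ σ, IsNClique n G idv σ ∧ u ∈ σ ∧ v ∈ σ)

/-- A set `A` of vertices of `G` is a union of `n`-vertex cliques of `G`. -/
def IsCliqueUnionSet (n : ℕ) (G : PGraph V) (idv : V → Fin n) (A : Set V) : Prop :=
  ∀ v ∈ A, ∃ σ, IsNClique n G idv σ ∧ σ ⊆ A ∧ v ∈ σ

/-- The vertex universe of the subdivision: old vertices (only terminated ones
are used) together with pairs `(i, τ)`. -/
abbrev SubV (V : Type) (n : ℕ) : Type := V ⊕ (Fin n × Set V)

/-- Identifier of a subdivision vertex. -/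
def subId (n : ℕ) (idv : V → Fin n) : SubV V n → Fin n
  | Sum.inl v => idv v
  | Sum.inr p => p.1

/-- Status of a subdivision vertex: old terminated vertices keep their output;
every pair `(i, τ)` is active. -/
def subStatus (n : ℕ) (δ : V → Option O) : SubV V n → Option O
  | Sum.inl v => δ v
  | Sum.inr _ => none

/-- Vertices of the subdivision `χ(σ,δ)` of an `n`-vertex clique `σ`:
the terminated vertices of `σ` together with all pairs `(i,τ)` where `τ` is a
subset of the active vertices of `σ` and `i ∈ id(τ)`. -/
def chiVerts (n : ℕ) (δ : V → Option O) (idv : V → Fin n) (σ : Set V) : Set (SubV V n) :=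
  {x | ∃ v ∈ σ, δ v ≠ none ∧ x = Sum.inl v} ∪
    {x | ∃ i τ, τ ⊆ {v ∈ σ | δ v = none} ∧ (∃ w ∈ τ, idv w = i) ∧ x = Sum.inr (i, τ)}

/-- Adjacency in the subdivision `χ(σ,δ)`. -/
def chiAdj (n : ℕ) (δ : V → Option O) (idv : V → Fin n) (σ : Set V) (x y : SubV V n) : Prop :=
  x ∈ chiVerts n δ idv σ ∧ y ∈ chiVerts n δ idv σ ∧ subId n idv x ≠ subId n idv y ∧
    ((∃ v, x = Sum.inl v) ∨ (∃ v, y = Sum.inl v) ∨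
      (∃ i τ j ρ, x = Sum.inr (i, τ) ∧ y = Sum.inr (j, ρ) ∧ (τ ⊆ ρ ∨ ρ ⊆ τ)))

theorem chiAdj_symm {n : ℕ} {δ : V → Option O} {idv : V → Fin n} {σ : Set V}
    {x y : SubV V n} (h : chiAdj n δ idv σ x y) : chiAdj n δ idv σ y x := by
  obtain ⟨hx, hy, hne, hc⟩ := h
  refine ⟨hy, hx, hne.symm, ?_⟩
  rcases hc with h | h | ⟨i, τ, j, ρ, hx', hy', hs⟩
  · exact Or.inr (Or.inl h)
  · exact Or.inl h
  · exact Or.inr (Or.inr ⟨j, ρ, i, τ, hy', hx', hs.symm⟩)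

/-- The subdivision `χ(σ,δ)` of an `n`-vertex clique `σ`, as a graph. -/
def chiCliqueGraph (n : ℕ) (δ : V → Option O) (idv : V → Fin n) (σ : Set V) :
    PGraph (SubV V n) where
  verts := chiVerts n δ idv σ
  Adj := chiAdj n δ idv σ
  symm := fun _ _ h => chiAdj_symm h
  adj_mem := fun _ _ h => ⟨h.1, h.2.1⟩

/-- The subdivision `χ(G,δ)` of a graph `G` that is a union of `n`-vertex
cliques: the union of the subdivisions of all its `n`-vertex cliques. -/
def chiGraph (n : ℕ) (G : PGraph V) (δ : V → Option O) (idv : V → Fin n) :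
    PGraph (SubV V n) where
  verts := {x | ∃ σ, IsNClique n G idv σ ∧ x ∈ chiVerts n δ idv σ}
  Adj x y := ∃ σ, IsNClique n G idv σ ∧ chiAdj n δ idv σ x y
  symm := fun _ _ h => h.elim fun σ hσ => ⟨σ, hσ.1, chiAdj_symm hσ.2⟩
  adj_mem := fun _ _ h => h.elim fun σ hσ => ⟨⟨σ, hσ.1, hσ.2.1⟩, ⟨σ, hσ.1, hσ.2.2.1⟩⟩

/-- The subdivision of a set `A` of vertices that is a union of `n`-vertex
cliques of `G`: the union of the subdivisions of the `n`-vertex cliques of `G`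
contained in `A`. -/
def chiSetCliques (n : ℕ) (G : PGraph V) (δ : V → Option O) (idv : V → Fin n) (A : Set V) :
    Set (SubV V n) :=
  {x | ∃ σ, IsNClique n G idv σ ∧ σ ⊆ A ∧ x ∈ chiVerts n δ idv σ}

/-- `A'` is the subdivision image `χ(A,δ)` of `A ⊆ G`, where `A` is either a set
of terminated vertices (in which case `χ(A,δ) = A`) or a union of `n`-vertex
cliques of `G`. -/
def IsChiImage (n : ℕ) (G : PGraph V) (δ : V → Option O) (idv : V → Fin n)
    (A : Set V) (A' : Set (SubV V n)) : Prop :=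
  ((∀ v ∈ A, δ v ≠ none) ∧ A' = Sum.inl '' A) ∨
    (IsCliqueUnionSet n G idv A ∧ A' = chiSetCliques n G δ idv A)

/-- `l` is a (nonempty) walk in `G` from a vertex of `A` to a vertex of `B`. -/
def IsWalkBetween (G : PGraph V) (A B : Set V) (l : List V) : Prop :=
  l.Chain' G.Adj ∧ (∀ v ∈ l, v ∈ G.verts) ∧
    ∃ h : l ≠ [], l.head h ∈ A ∧ l.getLast h ∈ B

/-- The distance between two sets of vertices: the minimum number of edges of a
path from a vertex of `A` to a vertex of `B` (`∞` if there is no such path). -/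
noncomputable def setDist (G : PGraph V) (A B : Set V) : ℕ∞ :=
  sInf {d : ℕ∞ | ∃ l : List V, IsWalkBetween G A B l ∧ (l.length : ℕ∞) = d + 1}

/-- `G` is connected: any two of its vertices are joined by a path. -/
def Connected (G : PGraph V) : Prop :=
  ∀ u ∈ G.verts, ∀ v ∈ G.verts, ∃ l, IsWalkBetween G {u} {v} l

/-- The list `l` contains an edge both of whose endpoints are active. -/
def HasActiveEdge (δ : V → Option O) (l : List V) : Prop :=
  ∃ l₁ l₂ u v, l = l₁ ++ u :: v :: l₂ ∧ δ u = none ∧ δ v = none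


theorem exists_walk_of_reflTransGen {V : Type} {G : PGraph V} {u v : V} (hv : v ∈ G.verts)
    (h : Relation.ReflTransGen G.Adj u v) : ∃ l, IsWalkBetween G {u} {v} l := by
  induction h using Relation.ReflTransGen.head_induction_on with
  | refl => exact ⟨[v], List.isChain_singleton v, by simpa using hv, by simp, by simp, by simp⟩
  | @head a c hac _ ih =>
    obtain ⟨l, hchain, hmem, hne, hhead, hlast⟩ := ih
    refine ⟨a :: l, ?_, ?_, by simp, by simp, ?_⟩
    · refine List.isChain_cons.2 ⟨fun y hy => ?_, hchain⟩
      rw [List.head?_eq_some_head hne, Option.mem_some_iff] at hy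
      rw [← hy, Set.mem_singleton_iff.1 hhead]
      exact hac
    · exact List.forall_mem_cons.2 ⟨(G.adj_mem _ _ hac).1, hmem⟩
    · rwa [List.getLast_cons hne]

/-- A graph in which every vertex reaches a common one is connected. -/
theorem connected_of_forall_reflTransGen {V : Type} {G : PGraph V} (c : V)
    (h : ∀ u ∈ G.verts, Relation.ReflTransGen G.Adj u c) : Connected G := fun u hu v hv =>
  have : Std.Symm G.Adj := ⟨G.symm⟩
  exists_walk_of_reflTransGen hv <| (h u hu).trans <|
    Relation.ReflTransGen.stdSymm.symm _ _ (h v hv)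

/-- A terminated vertex of the clique is adjacent to all other vertices of the subdivision. -/
theorem chiAdj_inl_of_ne {V O : Type} {n : ℕ} {δ : V → Option O} {idv : V → Fin n} {σ : Set V}
    (hid : Set.InjOn idv σ) {t : V} (ht : t ∈ σ) (hδ : δ t ≠ none) {x : SubV V n}
    (hx : x ∈ chiVerts n δ idv σ) (hne : x ≠ Sum.inl t) : chiAdj n δ idv σ x (Sum.inl t) := by
  refine ⟨hx, Or.inl ⟨t, ht, hδ, rfl⟩, fun heq => ?_, Or.inr (Or.inl ⟨t, rfl⟩)⟩
  rcases hx with ⟨v, hv, -, rfl⟩ | ⟨i, τ, hτ, ⟨w, hw, rfl⟩, rfl⟩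
  · exact hne (congrArg Sum.inl (hid hv ht heq))
  · exact hδ (hid (hτ hw).1 ht heq ▸ (hτ hw).2)

/-- If all vertices of the clique are active, a pair `(i, τ)` is adjacent to `(id w, σ)` whenever
`i ≠ id w`. -/
theorem chiAdj_inr_full {V O : Type} {n : ℕ} {δ : V → Option O} {idv : V → Fin n} {σ : Set V}
    (hact : ∀ v ∈ σ, δ v = none) {w : V} (hw : w ∈ σ) {i : Fin n} {τ : Set V}
    (hx : Sum.inr (i, τ) ∈ chiVerts n δ idv σ) (hτ : τ ⊆ σ) (hi : i ≠ idv w) :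
    chiAdj n δ idv σ (Sum.inr (i, τ)) (Sum.inr (idv w, σ)) :=
  ⟨hx, Or.inr ⟨idv w, σ, fun v hv => ⟨hv, hact v hv⟩, ⟨w, hw, rfl⟩, rfl⟩, hi,
    Or.inr (Or.inr ⟨i, τ, idv w, σ, rfl, rfl, Or.inl hτ⟩)⟩

/-- For every `n`-vertex clique `σ` with status function `δ`,
the subdivision `χ(σ,δ)` is a connected graph. -/
theorem subdivision_of_clique_connected {V O : Type} (n : ℕ) (hn : 2 ≤ n)
    (G : PGraph V) (idv : V → Fin n) (δ : V → Option O) (σ : Set V)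
    (hσ : IsNClique n G idv σ) :
    Connected (chiCliqueGraph n δ idv σ) := by
  obtain ⟨-, hfin, hcard, -, hid⟩ := hσ
  by_cases hT : ∃ t ∈ σ, δ t ≠ none
  · obtain ⟨t, ht, hδ⟩ := hT
    refine connected_of_forall_reflTransGen (Sum.inl t) fun x hx => ?_
    by_cases hxt : x = Sum.inl t
    · rw [hxt]
    · exact .single (chiAdj_inl_of_ne hid ht hδ hx hxt)
  · push Not at hT
    obtain ⟨a, ha, b, hb, hab⟩ := (Set.one_lt_ncard hfin).1 (hcard ▸ hn : 1 < σ.ncard)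
    have hba : idv b ≠ idv a := fun h => hab (hid hb ha h).symm
    refine connected_of_forall_reflTransGen (Sum.inr (idv a, σ)) fun x hx => ?_
    obtain ⟨v, hv, hδ, -⟩ | ⟨i, τ, hτ, -, rfl⟩ := id hx
    · exact absurd (hT v hv) hδ
    have hτσ : τ ⊆ σ := fun v hv => (hτ hv).1
    by_cases hi : i = idv a
    · have hxb := chiAdj_inr_full hT hb hx hτσ (hi.trans_ne hba.symm)
      exact .head hxb (.single (chiAdj_inr_full hT ha hxb.2.1 subset_rfl hba))
    · exact .single (chiAdj_inr_full hT ha hx hτσ hi)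

end EBP
end

section
/- Let 𝔸 be a connected graph that is a union of n-vertex cliques, with status function δ. Then χ(𝔸,δ) is connected. -/
set_option linter.dupNamespace false

namespace EBP

variable {V O : Type}

theorem connected_iff_reflTransGen {G : PGraph V} :
    Connected G ↔ ∀ u ∈ G.verts, ∀ v ∈ G.verts, Relation.ReflTransGen G.Adj u v := by
  refine ⟨fun h u hu v hv => ?_, fun h u hu v hv => ?_⟩
  · obtain ⟨l, hchain, -, hne, rfl, rfl⟩ := h u hu v hv
    exact List.relationReflTransGen_of_exists_isChain l hchain hne
  · obtain ⟨l, hne, hchain, hhead, hlast⟩ :=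
      List.exists_isChain_ne_nil_of_relationReflTransGen (h u hu v hv)
    refine ⟨l, hchain, fun w hw => ?_, hne, hhead, hlast⟩
    refine hchain.induction (· ∈ G.verts) l (fun x y hxy _ => (G.adj_mem x y hxy).2) ?_ w hw
    exact fun _ => hhead ▸ hu

/-- Every vertex of `G` has a canonical copy in the subdivision of each clique containing it. -/
theorem exists_mem_chiVerts (n : ℕ) (δ : V → Option O) (idv : V → Fin n) (v : V) :
    ∃ z, ∀ σ : Set V, v ∈ σ → z ∈ chiVerts n δ idv σ := by
  by_cases hv : δ v = none
  · refine ⟨Sum.inr (idv v, {v}), fun σ hσ => Or.inr ⟨idv v, {v}, ?_, ⟨v, rfl, rfl⟩, rfl⟩⟩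
    rintro _ rfl
    exact ⟨hσ, hv⟩
  · exact ⟨Sum.inl v, fun σ hσ => Or.inl ⟨v, hσ, hv, rfl⟩⟩

/-- For each `w ∈ σ`, the subdivision of `σ` has a vertex with the identifier of `w` that is
adjacent to all vertices with other identifiers. -/
theorem exists_center {n : ℕ} (δ : V → Option O) (idv : V → Fin n) {σ : Set V} {w : V}
    (hw : w ∈ σ) :
    ∃ c ∈ chiVerts n δ idv σ, subId n idv c = idv w ∧
      ∀ x ∈ chiVerts n δ idv σ, subId n idv x ≠ idv w → chiAdj n δ idv σ x c := by
  by_cases hδ : δ w = none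
  · have hc : (Sum.inr (idv w, {v ∈ σ | δ v = none}) : SubV V n) ∈ chiVerts n δ idv σ :=
      Or.inr ⟨_, _, subset_rfl, ⟨w, ⟨hw, hδ⟩, rfl⟩, rfl⟩
    refine ⟨_, hc, rfl, fun x hx hne => ⟨hx, hc, hne, ?_⟩⟩
    rcases hx with ⟨v, -, -, rfl⟩ | ⟨i, τ, hτ, -, rfl⟩
    · exact Or.inl ⟨v, rfl⟩
    · exact Or.inr (Or.inr ⟨i, τ, _, _, rfl, rfl, Or.inl hτ⟩)
  · have hc : (Sum.inl w : SubV V n) ∈ chiVerts n δ idv σ := Or.inl ⟨w, hw, hδ, rfl⟩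
    exact ⟨_, hc, rfl, fun x hx hne => ⟨hx, hc, hne, Or.inr (Or.inl ⟨w, rfl⟩)⟩⟩

theorem IsNClique.exists_id_ne {n : ℕ} {G : PGraph V} {idv : V → Fin n} {σ : Set V}
    (hσ : IsNClique n G idv σ) (hn : 2 ≤ n) (i : Fin n) : ∃ w ∈ σ, idv w ≠ i := by
  obtain ⟨-, hfin, hcard, -, hinj⟩ := hσ
  obtain ⟨a, ha, b, hb, hab⟩ := (Set.one_lt_ncard hfin).1 (by omega : 1 < σ.ncard)
  by_cases hai : idv a = i
  · exact ⟨b, hb, fun hbi => hab (hinj ha hb (hai.trans hbi.symm))⟩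
  · exact ⟨a, ha, hai⟩

theorem IsNClique.chi_connected {n : ℕ} (hn : 2 ≤ n) {G : PGraph V} {idv : V → Fin n}
    {σ : Set V} (hσ : IsNClique n G idv σ) (δ : V → Option O) :
    Connected (chiCliqueGraph n δ idv σ) := by
  refine connected_iff_reflTransGen.2 fun x hx y hy => ?_
  obtain ⟨w, hw, hwx⟩ := hσ.exists_id_ne hn (subId n idv x)
  obtain ⟨c, hc, hcw, hadj⟩ := exists_center δ idv hw
  refine .head (hadj x hx hwx.symm) ?_
  obtain ⟨w', hw', hwy⟩ := hσ.exists_id_ne hn (subId n idv y)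
  by_cases hww : idv w' = idv w
  · exact .single (chiAdj_symm (hadj y hy (hww ▸ hwy.symm)))
  · obtain ⟨c', -, -, hadj'⟩ := exists_center δ idv hw'
    exact .head (hadj' c hc (hcw ▸ Ne.symm hww)) (.single (chiAdj_symm (hadj' y hy hwy.symm)))

/-- Let `𝔸` be a connected graph that is a union of `n`-vertex
cliques, with status function `δ`. Then `χ(𝔸,δ)` is connected. -/
theorem subdivision_connected {V O : Type} (n : ℕ) (hn : 2 ≤ n)
    (A : PGraph V) (idv : V → Fin n) (δ : V → Option O)
    (hA : IsCliqueUnionGraph n A idv) (hconn : Connected A) :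
    Connected (chiGraph n A δ idv) := by
  have hclique : ∀ σ, IsNClique n A idv σ → ∀ x ∈ chiVerts n δ idv σ,
      ∀ y ∈ chiVerts n δ idv σ, Relation.ReflTransGen (chiGraph n A δ idv).Adj x y :=
    fun σ hσ x hx y hy =>
      Relation.ReflTransGen.mono (fun _ _ h => ⟨σ, hσ, h⟩) _ _
        (connected_iff_reflTransGen.1 (hσ.chi_connected hn δ) x hx y hy)
  refine connected_iff_reflTransGen.2 ?_
  rintro x ⟨σ, hσ, hx⟩ y ⟨ρ, hρ, hy⟩
  obtain ⟨u, hu, -⟩ := hσ.exists_id_ne hn (subId n idv x)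
  obtain ⟨v, hv, -⟩ := hρ.exists_id_ne hn (subId n idv y)
  choose φ hφ using exists_mem_chiVerts n δ idv
  have hpath : Relation.ReflTransGen (chiGraph n A δ idv).Adj (φ u) (φ v) := by
    refine (connected_iff_reflTransGen.1 hconn u (hσ.1 hu) v (hρ.1 hv)).lift' φ fun a b hab => ?_
    obtain ⟨τ, hτ, ha, hb⟩ := hA.2 a b hab
    exact hclique τ hτ _ (hφ a τ ha) _ (hφ b τ hb)
  exact ((hclique σ hσ x hx _ (hφ u σ hu)).trans hpath).trans (hclique ρ hρ _ (hφ v ρ hv) y hy)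

end EBP
end

section
/- Let 𝔾_0 be a graph that is a union of n-vertex cliques with status function δ_0 and, for each t ≥ 0, let 𝔾_{t+1} = χ(𝔾_t, δ_t), where δ_{t+1} is any status function on the vertices of 𝔾_{t+1} that assigns to each terminated vertex of 𝔾_t the same output it had under δ_t. Then each 𝔾_t is a union of n-vertex cliques and, if 𝔾_0 is connected, then 𝔾_t is connected for all t ≥ 1. -/
set_option linter.dupNamespace false

namespace EBP

variable {V O : Type}

/-- The vertex universe after `t` iterated subdivisions. -/
def IterV (V : Type) (n : ℕ) : ℕ → Type :=
  fun t => Nat.rec V (fun _ ih => SubV ih n) t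

/-- The identifier function after `t` iterated subdivisions. -/
def iterId (n : ℕ) (idv : V → Fin n) : (t : ℕ) → IterV V n t → Fin n :=
  fun t => Nat.rec (motive := fun t => IterV V n t → Fin n) idv (fun _ ih => subId n ih) t

/-- The copy of `v` in a subdivision: `v` itself if terminated, and `(id v, f v)` if active. -/
noncomputable def subCopy (n : ℕ) (δ : V → Option O) (idv : V → Fin n) (f : V → Set V) (v : V) :
    SubV V n :=
  open Classical in if δ v = none then Sum.inr (idv v, f v) else Sum.inl v

theorem subId_subCopy {n : ℕ} {δ : V → Option O} {idv : V → Fin n} (f : V → Set V) (v : V) :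
    subId n idv (subCopy n δ idv f v) = idv v := by
  unfold subCopy
  split_ifs <;> rfl

theorem subCopy_mem_chiVerts {n : ℕ} {δ : V → Option O} {idv : V → Fin n} {σ : Set V}
    {f : V → Set V} {v : V} (hv : v ∈ σ)
    (hf : δ v = none → v ∈ f v ∧ f v ⊆ {w ∈ σ | δ w = none}) :
    subCopy n δ idv f v ∈ chiVerts n δ idv σ := by
  unfold subCopy
  split_ifs with h
  · exact Or.inr ⟨idv v, f v, (hf h).2, ⟨v, (hf h).1, rfl⟩, rfl⟩
  · exact Or.inl ⟨v, hv, h, rfl⟩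

theorem isNClique_image_subCopy {n : ℕ} {G : PGraph V} {δ : V → Option O} {idv : V → Fin n}
    {σ : Set V} (hσ : IsNClique n G idv σ) {f : V → Set V}
    (hf : ∀ v ∈ σ, δ v = none → v ∈ f v ∧ f v ⊆ {w ∈ σ | δ w = none})
    (hchain : ∀ v w, f v ⊆ f w ∨ f w ⊆ f v) :
    IsNClique n (chiGraph n G δ idv) (subId n idv) (subCopy n δ idv f '' σ) := by
  have hmem : ∀ v ∈ σ, subCopy n δ idv f v ∈ chiVerts n δ idv σ := fun v hv =>
    subCopy_mem_chiVerts hv (hf v hv)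
  obtain ⟨-, hfin, hcard, -, hinj⟩ := id hσ
  refine ⟨?_, hfin.image _, ?_, ?_, ?_⟩
  · rintro _ ⟨v, hv, rfl⟩
    exact ⟨σ, hσ, hmem v hv⟩
  · rw [Set.InjOn.ncard_image, hcard]
    intro v hv w hw h
    have := congrArg (subId n idv) h
    rw [subId_subCopy, subId_subCopy] at this
    exact hinj hv hw this
  · rintro _ ⟨v, hv, rfl⟩ _ ⟨w, hw, rfl⟩ hne
    refine ⟨σ, hσ, hmem v hv, hmem w hw, ?_, ?_⟩
    · rw [subId_subCopy, subId_subCopy]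
      exact fun h => hne (by rw [hinj hv hw h])
    · unfold subCopy
      split_ifs
      · exact Or.inr (Or.inr ⟨_, _, _, _, rfl, rfl, hchain v w⟩)
      · exact Or.inr (Or.inl ⟨_, rfl⟩)
      · exact Or.inl ⟨_, rfl⟩
      · exact Or.inl ⟨_, rfl⟩
  · rintro _ ⟨v, hv, rfl⟩ _ ⟨w, hw, rfl⟩ h
    rw [subId_subCopy, subId_subCopy] at h
    rw [hinj hv hw h]

/-- Two compatible active vertices of the subdivision of a clique lie in an `n`-vertex clique,
which moreover contains all terminated vertices of the original clique. -/
theorem exists_isNClique_of_subset {n : ℕ} {G : PGraph V} {δ : V → Option O} {idv : V → Fin n}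
    {σ : Set V} (hσ : IsNClique n G idv σ) {i j : Fin n} {τ ρ : Set V}
    (hi : Sum.inr (i, τ) ∈ chiVerts n δ idv σ) (hj : Sum.inr (j, ρ) ∈ chiVerts n δ idv σ)
    (hsub : τ ⊆ ρ) (heq : i = j → τ = ρ) :
    ∃ κ, IsNClique n (chiGraph n G δ idv) (subId n idv) κ ∧
      Sum.inr (i, τ) ∈ κ ∧ Sum.inr (j, ρ) ∈ κ ∧
      ∀ v ∈ σ, δ v ≠ none → Sum.inl v ∈ κ := by
  obtain ⟨hτ, u, hu, rfl⟩ : τ ⊆ {v ∈ σ | δ v = none} ∧ ∃ w ∈ τ, idv w = i := by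
    simpa [chiVerts, eq_comm] using hi
  obtain ⟨hρ, u', hu', rfl⟩ : ρ ⊆ {v ∈ σ | δ v = none} ∧ ∃ w ∈ ρ, idv w = j := by
    simpa [chiVerts, eq_comm] using hj
  have hinj := hσ.2.2.2.2
  classical
  let f : V → Set V := fun v =>
    if idv v = idv u then τ else if idv v = idv u' then ρ else {v ∈ σ | δ v = none}
  have hfu : f u = τ := if_pos rfl
  have hfu' : f u' = ρ := by
    by_cases h : idv u' = idv u
    · simpa [f, h] using heq h.symm
    · simp [f, h]
  refine ⟨_, isNClique_image_subCopy (δ := δ) hσ (f := f) ?_ ?_, ⟨u, (hτ hu).1, ?_⟩,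
    ⟨u', (hρ hu').1, ?_⟩, fun v hv h => ⟨v, hv, by simp [subCopy, h]⟩⟩
  · intro v hv hδ
    simp only [f]
    split_ifs with h h'
    · exact ⟨hinj hv (hτ hu).1 h ▸ hu, hτ⟩
    · exact ⟨hinj hv (hρ hu').1 h' ▸ hu', hρ⟩
    · exact ⟨⟨hv, hδ⟩, subset_rfl⟩
  · intro v w
    have hτA := hsub.trans hρ
    simp only [f]
    split_ifs <;> simp only [hsub, hρ, hτA, subset_rfl, true_or, or_true]
  · simp [subCopy, (hτ hu).2, hfu]
  · simp [subCopy, (hρ hu').2, hfu']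

theorem exists_isNClique_terminated {n : ℕ} {G : PGraph V} {δ : V → Option O} {idv : V → Fin n}
    {σ : Set V} (hσ : IsNClique n G idv σ) :
    ∃ κ, IsNClique n (chiGraph n G δ idv) (subId n idv) κ ∧
      ∀ v ∈ σ, δ v ≠ none → Sum.inl v ∈ κ :=
  ⟨_, isNClique_image_subCopy (δ := δ) hσ (f := fun _ => {w ∈ σ | δ w = none})
    (fun _ hv hδ => ⟨⟨hv, hδ⟩, subset_rfl⟩) (fun _ _ => Or.inl subset_rfl),
    fun v hv h => ⟨v, hv, by simp [subCopy, h]⟩⟩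

theorem inl_mem_chiVerts {n : ℕ} {δ : V → Option O} {idv : V → Fin n} {σ : Set V} {v : V} :
    Sum.inl v ∈ chiVerts n δ idv σ ↔ v ∈ σ ∧ δ v ≠ none := by
  simp [chiVerts]

theorem isCliqueUnionGraph_chiGraph (n : ℕ) (G : PGraph V) (δ : V → Option O) (idv : V → Fin n) :
    IsCliqueUnionGraph n (chiGraph n G δ idv) (subId n idv) := by
  constructor
  · rintro (v | ⟨i, τ⟩) ⟨σ, hσ, hx⟩
    · obtain ⟨hv, hδ⟩ := inl_mem_chiVerts.1 hx
      obtain ⟨κ, hκ, h⟩ := exists_isNClique_terminated (δ := δ) hσ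
      exact ⟨κ, hκ, h v hv hδ⟩
    · obtain ⟨κ, hκ, h, -⟩ := exists_isNClique_of_subset hσ hx hx subset_rfl fun _ => rfl
      exact ⟨κ, hκ, h⟩
  · rintro (v | ⟨i, τ⟩) (w | ⟨j, ρ⟩) ⟨σ, hσ, hx, hy, hne, hadj⟩
    · obtain ⟨hv, hδv⟩ := inl_mem_chiVerts.1 hx
      obtain ⟨hw, hδw⟩ := inl_mem_chiVerts.1 hy
      obtain ⟨κ, hκ, h⟩ := exists_isNClique_terminated (δ := δ) hσ
      exact ⟨κ, hκ, h v hv hδv, h w hw hδw⟩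
    · obtain ⟨hv, hδv⟩ := inl_mem_chiVerts.1 hx
      obtain ⟨κ, hκ, h, -, h'⟩ := exists_isNClique_of_subset hσ hy hy subset_rfl fun _ => rfl
      exact ⟨κ, hκ, h' v hv hδv, h⟩
    · obtain ⟨hw, hδw⟩ := inl_mem_chiVerts.1 hy
      obtain ⟨κ, hκ, h, -, h'⟩ := exists_isNClique_of_subset hσ hx hx subset_rfl fun _ => rfl
      exact ⟨κ, hκ, h, h' w hw hδw⟩
    · have hij : i ≠ j := hne
      obtain h | h : τ ⊆ ρ ∨ ρ ⊆ τ := by simpa using hadj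
      · obtain ⟨κ, hκ, h₁, h₂, -⟩ :=
          exists_isNClique_of_subset hσ hx hy h fun e => absurd e hij
        exact ⟨κ, hκ, h₁, h₂⟩
      · obtain ⟨κ, hκ, h₁, h₂, -⟩ :=
          exists_isNClique_of_subset hσ hy hx h fun e => absurd e.symm hij
        exact ⟨κ, hκ, h₂, h₁⟩

theorem IsWalkBetween.reflTransGen {G : PGraph V} {u v : V} {l : List V}
    (h : IsWalkBetween G {u} {v} l) : Relation.ReflTransGen G.Adj u v := by
  obtain ⟨hc, -, hne, hu, hv⟩ := h
  have := List.relationReflTransGen_of_exists_isChain l hc hne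
  rwa [Set.mem_singleton_iff.1 hu, Set.mem_singleton_iff.1 hv] at this

theorem exists_isWalkBetween {G : PGraph V} {u v : V} (hv : v ∈ G.verts)
    (h : Relation.ReflTransGen G.Adj u v) : ∃ l, IsWalkBetween G {u} {v} l := by
  induction h using Relation.ReflTransGen.head_induction_on with
  | refl => exact ⟨[v], List.isChain_singleton v, by simpa using hv, by simp⟩
  | @head a b hab _ ih =>
    obtain ⟨l, hc, hl, hne, hhead, hlast⟩ := ih
    refine ⟨a :: l, List.isChain_cons.2 ⟨?_, hc⟩, ?_, List.cons_ne_nil _ _, rfl, ?_⟩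
    · intro y hy
      rw [List.head?_eq_some_head hne, Option.mem_some_iff] at hy
      rwa [← hy, Set.mem_singleton_iff.1 hhead]
    · simpa using ⟨(G.adj_mem _ _ hab).1, hl⟩
    · rwa [List.getLast_cons hne]

/-- The subdivision of a clique is connected. -/
theorem reflTransGen_of_mem_chiVerts {n : ℕ} (hn : 2 ≤ n) {G : PGraph V} {δ : V → Option O}
    {idv : V → Fin n} {σ : Set V} (hσ : IsNClique n G idv σ) {x y : SubV V n}
    (hx : x ∈ chiVerts n δ idv σ) (hy : y ∈ chiVerts n δ idv σ) :
    Relation.ReflTransGen (chiGraph n G δ idv).Adj x y := by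
  set f : V → Set V := fun _ => {w ∈ σ | δ w = none}
  have hf : ∀ v ∈ σ, δ v = none → v ∈ f v ∧ f v ⊆ {w ∈ σ | δ w = none} :=
    fun v hv hδ => ⟨⟨hv, hδ⟩, subset_rfl⟩
  have hub : ∀ z ∈ chiVerts n δ idv σ, ∃ w ∈ σ,
      (chiGraph n G δ idv).Adj z (subCopy n δ idv f w) := by
    intro z hz
    obtain ⟨w, hw, hwz⟩ : ∃ w ∈ σ, idv w ≠ subId n idv z := by
      obtain ⟨-, hfin, hcard, -, hinj⟩ := hσ
      obtain ⟨a, b, ha, hb, hab⟩ := (Set.one_lt_ncard_iff hfin).1 (by omega)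
      by_cases h : idv a = subId n idv z
      · exact ⟨b, hb, fun h' => hab (hinj ha hb (h.trans h'.symm))⟩
      · exact ⟨a, ha, h⟩
    refine ⟨w, hw, σ, hσ, hz, subCopy_mem_chiVerts hw (hf w hw), ?_, ?_⟩
    · rw [subId_subCopy]
      exact hwz.symm
    · rcases z with v | ⟨i, τ⟩
      · exact Or.inl ⟨v, rfl⟩
      · have hτ : τ ⊆ {v ∈ σ | δ v = none} := by
          simp only [chiVerts, Set.mem_union, Set.mem_ofPred_eq] at hz
          simp_all
        unfold subCopy
        split_ifs
        · exact Or.inr (Or.inr ⟨_, _, _, _, rfl, rfl, Or.inl hτ⟩)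
        · exact Or.inr (Or.inl ⟨_, rfl⟩)
  obtain ⟨v, hv, hxv⟩ := hub x hx
  obtain ⟨w, hw, hyw⟩ := hub y hy
  refine .head hxv (.tail ?_ ((chiGraph n G δ idv).symm _ _ hyw))
  by_cases h : subCopy n δ idv f v = subCopy n δ idv f w
  · rw [h]
  · exact .single ((isNClique_image_subCopy hσ hf fun _ _ => Or.inl subset_rfl).2.2.2.1
      _ ⟨v, hv, rfl⟩ _ ⟨w, hw, rfl⟩ h)

theorem Connected.chiGraph {n : ℕ} (hn : 2 ≤ n) {G : PGraph V} (δ : V → Option O)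
    {idv : V → Fin n} (hG : IsCliqueUnionGraph n G idv) (hconn : Connected G) :
    Connected (chiGraph n G δ idv) := by
  rintro x ⟨σ, hσ, hx⟩ y ⟨κ, hκ, hy⟩
  refine exists_isWalkBetween ⟨κ, hκ, hy⟩ ?_
  have hne : ∀ {s : Set V}, IsNClique n G idv s → ∃ v, v ∈ s := fun hs =>
    Set.nonempty_of_ncard_ne_zero (by rw [hs.2.2.1]; omega)
  obtain ⟨v, hv⟩ := hne hσ
  obtain ⟨w, hw⟩ := hne hκ
  have hmem : ∀ {s : Set V} {u : V}, u ∈ s →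
      subCopy n δ idv (fun a => {a}) u ∈ chiVerts n δ idv s := fun {s u} hu =>
    subCopy_mem_chiVerts hu fun hδ => ⟨rfl, by simp [hu, hδ]⟩
  refine (reflTransGen_of_mem_chiVerts hn hσ hx (hmem hv)).trans
    (.trans ?_ (reflTransGen_of_mem_chiVerts hn hκ (hmem hw) hy))
  obtain ⟨l, hl⟩ := hconn v (hσ.1 hv) w (hκ.1 hw)
  have hvw := hl.reflTransGen
  clear hw hl
  induction hvw with
  | refl => exact .refl
  | tail _ hab ih =>
    obtain ⟨s, hs, ha, hb⟩ := hG.2 _ _ hab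
    exact ih.trans (reflTransGen_of_mem_chiVerts hn hs (hmem ha) (hmem hb))

/-- Let `𝔾₀` be a graph that is a union of `n`-vertex cliques
with status function `δ₀` and, for each `t ≥ 0`, let `𝔾_{t+1} = χ(𝔾_t, δ_t)`,
where `δ_{t+1}` is any status function on the vertices of `𝔾_{t+1}` that assigns
to each terminated vertex of `𝔾_t` the same output it had under `δ_t`. Then each
`𝔾_t` is a union of `n`-vertex cliques and, if `𝔾₀` is connected, then `𝔾_t` is
connected for all `t ≥ 1`. -/
theorem iterated_subdivision_connected {V O : Type} (n : ℕ) (hn : 2 ≤ n)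
    (idv : V → Fin n)
    (G : ∀ t, PGraph (IterV V n t))
    (δ : ∀ t, IterV V n t → Option O)
    (hG0 : IsCliqueUnionGraph n (G 0) (iterId n idv 0))
    (hGrec : ∀ t, G (t + 1) = chiGraph n (G t) (δ t) (iterId n idv t))
    (hδ : ∀ (t : ℕ) (v : IterV V n t), δ t v ≠ none → δ (t + 1) (Sum.inl v) = δ t v) :
    (∀ t, IsCliqueUnionGraph n (G t) (iterId n idv t)) ∧
      (Connected (G 0) → ∀ t, 1 ≤ t → Connected (G t)) := by
  have hunion : ∀ t, IsCliqueUnionGraph n (G t) (iterId n idv t) := by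
    rintro (_ | t)
    · exact hG0
    · rw [hGrec]
      exact isCliqueUnionGraph_chiGraph n (G t) (δ t) (iterId n idv t)
  refine ⟨hunion, fun hconn t _ => ?_⟩
  clear * - hn hconn hunion hGrec
  induction t with
  | zero => exact hconn
  | succ t ih =>
    rw [hGrec]
    exact ih.chiGraph hn (δ t) (hunion t)

end EBP
end

section
/- Let G be a union of n-vertex cliques with status function δ, and suppose 𝔸, 𝔹 ⊆ G are nonempty and each is either a set of terminated vertices of G or a union of n-vertex cliques of G. Then the distance between χ(𝔸,δ) and χ(𝔹,δ) in χ(G,δ) is at least as large as the distance between 𝔸 and 𝔹 in G. -/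
set_option linter.dupNamespace false

namespace EBP

variable {V O : Type}

/-- There is a retraction of the subdivision vertices onto the original vertices which preserves
identifiers and maps the subdivision of every clique `σ` into `σ`. It sends `(i, τ)` to a vertex
of `τ` with identifier `i`. -/
theorem exists_carrier_retraction [Nonempty V] (n : ℕ) (δ : V → Option O) (idv : V → Fin n) :
    ∃ f : SubV V n → V, (∀ v, f (Sum.inl v) = v) ∧
      ∀ σ, ∀ x ∈ chiVerts n δ idv σ, f x ∈ σ ∧ idv (f x) = subId n idv x := by
  have key (p : Fin n × Set V) : ∃ w, (∃ w ∈ p.2, idv w = p.1) → w ∈ p.2 ∧ idv w = p.1 := by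
    by_cases h : ∃ w ∈ p.2, idv w = p.1
    · obtain ⟨w, hw⟩ := h
      exact ⟨w, fun _ => hw⟩
    · exact ⟨Classical.arbitrary V, fun h' => absurd h' h⟩
  choose g hg using key
  refine ⟨Sum.elim id g, fun v => rfl, ?_⟩
  rintro σ x (⟨v, hv, -, rfl⟩ | ⟨i, τ, hτ, hw, rfl⟩)
  · exact ⟨hv, rfl⟩
  · obtain ⟨hmem, hid⟩ := hg (i, τ) hw
    exact ⟨(hτ hmem).1, hid⟩

/-- A map of graphs preserving vertices and adjacency, and mapping `A'` into `A` and `B'` into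
`B`, does not increase the distance between the two sets. -/
theorem setDist_le_of_hom {W : Type} {G : PGraph V} {H : PGraph W} {A B : Set V} {A' B' : Set W}
    (f : W → V) (hverts : ∀ x ∈ H.verts, f x ∈ G.verts)
    (hadj : ∀ x y, H.Adj x y → G.Adj (f x) (f y))
    (hA : ∀ x ∈ A', f x ∈ A) (hB : ∀ x ∈ B', f x ∈ B) :
    setDist G A B ≤ setDist H A' B' := by
  refine sInf_le_sInf ?_
  rintro d ⟨l, ⟨hchain, hmem, hne, hhead, hlast⟩, hlen⟩
  refine ⟨l.map f, ⟨?_, ?_, ?_, ?_, ?_⟩, ?_⟩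
  · exact List.isChain_map_of_isChain f (fun x y => hadj x y) hchain
  · intro v hv
    obtain ⟨x, hx, rfl⟩ := List.mem_map.1 hv
    exact hverts x (hmem x hx)
  · simpa using hne
  · rw [List.head_map]
    exact hA _ hhead
  · rw [List.getLast_map]
    exact hB _ hlast
  · rw [List.length_map]
    exact hlen

/-- A retraction as in `exists_carrier_retraction` maps the subdivision of `A` into `A`. -/
theorem IsChiImage.map_mem {n : ℕ} {G : PGraph V} {δ : V → Option O} {idv : V → Fin n}
    {A : Set V} {A' : Set (SubV V n)} (h : IsChiImage n G δ idv A A') {f : SubV V n → V}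
    (hinl : ∀ v, f (Sum.inl v) = v) (hmem : ∀ σ, ∀ x ∈ chiVerts n δ idv σ, f x ∈ σ) :
    ∀ x ∈ A', f x ∈ A := by
  rcases h with ⟨-, rfl⟩ | ⟨-, rfl⟩
  · rintro _ ⟨v, hv, rfl⟩
    rwa [hinl]
  · rintro x ⟨σ, -, hσA, hx⟩
    exact hσA (hmem σ x hx)

/-- Let `G` be a union of `n`-vertex cliques with status
function `δ`, and suppose `𝔸, 𝔹 ⊆ G` are nonempty and each is either a set of
terminated vertices of `G` or a union of `n`-vertex cliques of `G`. Then the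
distance between `χ(𝔸,δ)` and `χ(𝔹,δ)` in `χ(G,δ)` is at least as large as the
distance between `𝔸` and `𝔹` in `G`. -/
theorem subdivision_dist_mono {V O : Type} (n : ℕ) (hn : 2 ≤ n)
    (G : PGraph V) (idv : V → Fin n) (δ : V → Option O)
    (hG : IsCliqueUnionGraph n G idv)
    (A B : Set V) (hA : A ⊆ G.verts) (hB : B ⊆ G.verts)
    (hAne : A.Nonempty) (hBne : B.Nonempty)
    (A' B' : Set (SubV V n))
    (hA' : IsChiImage n G δ idv A A') (hB' : IsChiImage n G δ idv B B') :
    setDist G A B ≤ setDist (chiGraph n G δ idv) A' B' := by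
  have : Nonempty V := hAne.to_type
  obtain ⟨f, hinl, hf⟩ := exists_carrier_retraction n δ idv
  have hmem : ∀ σ, ∀ x ∈ chiVerts n δ idv σ, f x ∈ σ := fun σ x hx => (hf σ x hx).1
  refine setDist_le_of_hom f ?_ ?_ (hA'.map_mem hinl hmem) (hB'.map_mem hinl hmem)
  · rintro x ⟨σ, hσ, hx⟩
    exact hσ.1 (hmem σ x hx)
  · rintro x y ⟨σ, ⟨-, -, -, hclique, -⟩, hx, hy, hne, -⟩
    refine hclique _ (hmem σ x hx) _ (hmem σ y hy) fun hxy => hne ?_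
    rw [← (hf σ x hx).2, ← (hf σ y hy).2, hxy]

end EBP
end

section
/- Let G be a union of n-vertex cliques with status function δ. Suppose 𝔸, 𝔹, ℂ are nonempty unions of n-vertex cliques of G such that 𝔸 ∩ ℂ is nonempty, 𝔹 ∩ ℂ is nonempty, 𝔸 and 𝔹 are vertex-disjoint, and every vertex of ℂ is active. Then the distance between χ(𝔸,δ) ∩ χ(ℂ,δ) and χ(𝔹,δ) ∩ χ(ℂ,δ) in χ(G,δ) is at least 2. -/
set_option linter.dupNamespace false

namespace EBP

variable {V O : Type}

/-- In the subdivision of a union `C` of cliques of active vertices, every vertex that also lies in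
the subdivision of `A` is a pair `(i, τ)` with `τ` a nonempty subset of `A`. -/
theorem exists_eq_inr_of_mem_chiSetCliques {n : ℕ} {G : PGraph V} {δ : V → Option O}
    {idv : V → Fin n} {A C : Set V} (hC : ∀ v ∈ C, δ v = none) {x : SubV V n}
    (hx : x ∈ chiSetCliques n G δ idv A ∩ chiSetCliques n G δ idv C) :
    ∃ i τ, x = Sum.inr (i, τ) ∧ τ ⊆ A ∧ τ.Nonempty := by
  obtain ⟨⟨σ, -, hσA, hxA⟩, ⟨σ', -, hσC, hxC⟩⟩ := hx
  rcases hxC with ⟨v, hv, hne, -⟩ | ⟨i, τ, -, ⟨w, hw, -⟩, rfl⟩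
  · exact absurd (hC v (hσC hv)) hne
  · rcases hxA with ⟨v, -, -, h⟩ | ⟨j, ρ, hρ, -, h⟩
    · cases h
    · cases h
      exact ⟨i, τ, rfl, fun u hu => hσA (hρ hu).1, w, hw⟩

/-- Let `G` be a union of `n`-vertex cliques with status
function `δ`. Suppose `𝔸, 𝔹, ℂ` are nonempty unions of `n`-vertex cliques of
`G` such that `𝔸 ∩ ℂ` is nonempty, `𝔹 ∩ ℂ` is nonempty, `𝔸` and `𝔹` are
vertex-disjoint, and every vertex of `ℂ` is active. Then the distance between
`χ(𝔸,δ) ∩ χ(ℂ,δ)` and `χ(𝔹,δ) ∩ χ(ℂ,δ)` in `χ(G,δ)` is at least 2. -/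
theorem subdivision_dist_two {V O : Type} (n : ℕ) (hn : 2 ≤ n)
    (G : PGraph V) (idv : V → Fin n) (δ : V → Option O)
    (hG : IsCliqueUnionGraph n G idv)
    (A B C : Set V)
    (hA : IsCliqueUnionSet n G idv A) (hB : IsCliqueUnionSet n G idv B)
    (hC : IsCliqueUnionSet n G idv C)
    (hAne : A.Nonempty) (hBne : B.Nonempty) (hCne : C.Nonempty)
    (hAC : (A ∩ C).Nonempty) (hBC : (B ∩ C).Nonempty)
    (hAB : Disjoint A B)
    (hCactive : ∀ v ∈ C, δ v = none) :
    2 ≤ setDist (chiGraph n G δ idv)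
        (chiSetCliques n G δ idv A ∩ chiSetCliques n G δ idv C)
        (chiSetCliques n G δ idv B ∩ chiSetCliques n G δ idv C) := by
  refine le_sInf ?_
  rintro d ⟨l, ⟨hchain, -, hl, hhead, hlast⟩, hlen⟩
  obtain ⟨i, τ, hx, hτ, hτne⟩ := exists_eq_inr_of_mem_chiSetCliques hCactive hhead
  obtain ⟨j, ρ, hy, hρ, hρne⟩ := exists_eq_inr_of_mem_chiSetCliques hCactive hlast
  have hnot : ¬ (τ ⊆ ρ ∨ ρ ⊆ τ) := by
    rintro (h | h)
    · obtain ⟨w, hw⟩ := hτne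
      exact Set.disjoint_left.1 hAB (hτ hw) (hρ (h hw))
    · obtain ⟨w, hw⟩ := hρne
      exact Set.disjoint_left.1 hAB (hτ (h hw)) (hρ hw)
  match l, hl with
  | [x], _ =>
    simp only [List.head_cons, List.getLast_singleton] at hx hy
    rw [hx] at hy
    cases hy
    exact absurd (Or.inl subset_rfl) hnot
  | [x, y], _ =>
    simp only [List.head_cons, List.getLast_cons_cons, List.getLast_singleton] at hx hy
    subst hx hy
    have hadj : (chiGraph n G δ idv).Adj (Sum.inr (i, τ)) (Sum.inr (j, ρ)) :=
      List.isChain_pair.1 hchain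
    obtain ⟨σ, -, -, -, -, ⟨v, h⟩ | ⟨v, h⟩ | ⟨i', τ', j', ρ', h₁, h₂, h⟩⟩ := hadj
    · cases h
    · cases h
    · cases h₁
      cases h₂
      exact absurd h hnot
  | x :: y :: z :: l, _ =>
    cases d with
    | top => exact le_top
    | coe d =>
      have hlen' : l.length + 3 = d + 1 := by
        simp only [List.length_cons] at hlen
        exact_mod_cast hlen
      exact_mod_cast (show 2 ≤ d by omega)

end EBP
end

section
/- Let G be a union of n-vertex cliques with status function δ, and let 𝔸 and 𝔹 be nonempty sets of vertices of G. If every path between 𝔸 and 𝔹 in G contains at least one edge both of whose endpoints are active, then every path between 𝔸 and 𝔹 in G contains at least one edge e such that every n-vertex clique of G containing e consists entirely of active vertices. -/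
set_option linter.dupNamespace false

namespace EBP

variable {V O : Type}

/-- Two adjacent vertices in a clique with a terminated vertex are joined by a walk
without edges between active vertices. -/
theorem reflTransGen_of_mem_clique {n : ℕ} {G : PGraph V} {idv : V → Fin n} {δ : V → Option O}
    {σ : Set V} (hσ : IsNClique n G idv σ) {u v w : V} (huv : G.Adj u v) (hu : u ∈ σ)
    (hv : v ∈ σ) (hw : w ∈ σ) (hδw : δ w ≠ none) :
    Relation.ReflTransGen (fun x y => G.Adj x y ∧ ¬(δ x = none ∧ δ y = none)) u v := by
  by_cases h : δ u = none ∧ δ v = none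
  · have huw : u ≠ w := fun e => hδw (e ▸ h.1)
    have hwv : w ≠ v := fun e => hδw (e ▸ h.2)
    have hadj := hσ.2.2.2.1
    exact (Relation.ReflTransGen.single ⟨hadj u hu w hw huw, fun k => hδw k.2⟩).tail
      ⟨hadj w hw v hv hwv, fun k => hδw k.1⟩
  · exact .single ⟨huv, h⟩

/-- Let `G` be a union of `n`-vertex cliques with status
function `δ`, and let `𝔸` and `𝔹` be nonempty sets of vertices of `G`. If every
path between `𝔸` and `𝔹` in `G` contains at least one edge both of whose
endpoints are active, then every path between `𝔸` and `𝔹` in `G` contains at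
least one edge `e` such that every `n`-vertex clique of `G` containing `e`
consists entirely of active vertices. -/
theorem walk_has_all_active_clique_edge {V O : Type} (n : ℕ) (hn : 2 ≤ n)
    (G : PGraph V) (idv : V → Fin n) (δ : V → Option O)
    (hG : IsCliqueUnionGraph n G idv)
    (A B : Set V) (hA : A ⊆ G.verts) (hB : B ⊆ G.verts)
    (hAne : A.Nonempty) (hBne : B.Nonempty)
    (hpaths : ∀ l, IsWalkBetween G A B l → HasActiveEdge δ l) :
    ∀ l, IsWalkBetween G A B l →
      ∃ l₁ l₂ u v, l = l₁ ++ u :: v :: l₂ ∧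
        ∀ σ, IsNClique n G idv σ → u ∈ σ → v ∈ σ → ∀ w ∈ σ, δ w = none := by
  rintro l ⟨hchain, -, hne, hhead, hlast⟩
  by_contra! hcon
  have hreach : Relation.ReflTransGen
      (fun x y => G.Adj x y ∧ ¬(δ x = none ∧ δ y = none)) (l.head hne) (l.getLast hne) := by
    have hstep : l.IsChain
        (Relation.ReflTransGen fun x y => G.Adj x y ∧ ¬(δ x = none ∧ δ y = none)) := by
      rw [List.isChain_iff_forall_rel_of_append_cons_cons]
      intro u v l₁ l₂ hl
      obtain ⟨σ, hσ, hu, hv, w, hw, hδw⟩ := hcon l₁ l₂ u v hl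
      exact reflTransGen_of_mem_clique hσ
        (List.isChain_iff_forall_rel_of_append_cons_cons.1 hchain hl) hu hv hw hδw
    simpa only [Relation.reflTransGen_eq_self] using
      List.relationReflTransGen_of_exists_isChain l hstep hne
  obtain ⟨t, ht, htlast⟩ := List.exists_isChain_cons_of_relationReflTransGen hreach
  have hmem : ∀ v ∈ l.head hne :: t, v ∈ G.verts :=
    ht.induction (· ∈ G.verts) _ (fun x y h _ => (G.adj_mem x y h.1).2) fun _ => hA hhead
  obtain ⟨l₁, l₂, u, v, heq, hu, hv⟩ := hpaths (l.head hne :: t)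
    ⟨ht.imp fun _ _ h => h.1, hmem, List.cons_ne_nil _ _, hhead, htlast ▸ hlast⟩
  exact (List.isChain_iff_forall_rel_of_append_cons_cons.1 ht heq).2 ⟨hu, hv⟩

end EBP
end

section
/- In the iterated construction for k-set agreement inputs, for every t ≥ 0, every input value a ∈ {0,…,k}, and every subset τ of an n-vertex clique of 𝔾_t such that no vertex of τ has seen a, there exists an n-vertex clique of N_t(a) that contains τ. -/
set_option linter.dupNamespace false

namespace EBP

variable {V O : Type}

/-- The vertices of the input graph `𝔾₀` for `k`-set agreement:
pairs `(i, x)` of a process identifier and an input value. -/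
abbrev KV (n k : ℕ) : Type := Fin n × Fin (k + 1)

/-- The input graph `𝔾₀` for `k`-set agreement: two vertices are adjacent iff
their identifiers differ. -/
def G0 (n k : ℕ) : PGraph (KV n k) where
  verts := Set.univ
  Adj u v := u.1 ≠ v.1
  symm := fun _ _ h => h.symm
  adj_mem := fun _ _ _ => ⟨trivial, trivial⟩

/-- The predicate "vertex `x` of `𝔾ₜ` has seen the input value `a`". -/
def seen (n k : ℕ) : (t : ℕ) → IterV (KV n k) n t → Fin (k + 1) → Prop :=
  fun t => Nat.rec (motive := fun t => IterV (KV n k) n t → Fin (k + 1) → Prop)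
    (fun v a => (v : KV n k).2 = a)
    (fun _ ih x a =>
      Sum.elim (fun v => ih v a) (fun p => ∃ w ∈ p.2, ih w a) x) t

/-- `N_t(a)`: the union of all `n`-vertex cliques of `𝔾ₜ` none of whose
vertices has seen `a`. -/
def Nset (n k : ℕ) (G : ∀ t, PGraph (IterV (KV n k) n t)) (t : ℕ) (a : Fin (k + 1)) :
    Set (IterV (KV n k) n t) :=
  {x | ∃ σ, IsNClique n (G t) (iterId n (fun v : KV n k => v.1) t) σ ∧
        (∀ w ∈ σ, ¬ seen n k t w a) ∧ x ∈ σ}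

/-- `T_t(a)`: the set of terminated vertices of `𝔾ₜ` with output `a`. -/
def Tset (n k : ℕ) (G : ∀ t, PGraph (IterV (KV n k) n t))
    (δ : ∀ t, IterV (KV n k) n t → Option (Fin (k + 1))) (t : ℕ) (a : Fin (k + 1)) :
    Set (IterV (KV n k) n t) :=
  {x | x ∈ (G t).verts ∧ δ t x = some a}

/-- Every set of pairwise adjacent vertices of `G` satisfying `P` extends to an
`n`-vertex clique whose vertices all satisfy `P`. -/
def CliquesExtend (n : ℕ) (G : PGraph V) (idv : V → Fin n) (P : V → Prop) : Prop :=
  ∀ τ ⊆ G.verts, (∀ u ∈ τ, ∀ v ∈ τ, u ≠ v → G.Adj u v) → (∀ w ∈ τ, P w) →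
    ∃ ρ, IsNClique n G idv ρ ∧ τ ⊆ ρ ∧ ∀ w ∈ ρ, P w

theorem IsNClique.of_image {ι : Type} {n : ℕ} {G : PGraph V} {idv : V → Fin n}
    {s : Set ι} {e : ι → Fin n} {f : ι → V} (hfin : s.Finite) (hcard : s.ncard = n)
    (he : Set.InjOn e s) (hid : ∀ i ∈ s, idv (f i) = e i) (hv : ∀ i ∈ s, f i ∈ G.verts)
    (hadj : ∀ i ∈ s, ∀ j ∈ s, e i ≠ e j → G.Adj (f i) (f j)) :
    IsNClique n G idv (f '' s) := by
  have hinj : Set.InjOn f s := fun i hi j hj h => he hi hj (by rw [← hid i hi, ← hid j hj, h])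
  refine ⟨Set.image_subset_iff.2 hv, hfin.image f, by rw [hinj.ncard_image, hcard],
    ?_, ?_⟩
  · rintro _ ⟨i, hi, rfl⟩ _ ⟨j, hj, rfl⟩ hne
    exact hadj i hi j hj fun h => hne (congrArg f (he hi hj h))
  · rintro _ ⟨i, hi, rfl⟩ _ ⟨j, hj, rfl⟩ h
    rw [hid i hi, hid j hj] at h
    exact congrArg f (he hi hj h)

theorem cliquesExtend_G0 {n k : ℕ} (hk : 1 ≤ k) (a : Fin (k + 1)) :
    CliquesExtend n (G0 n k) (fun v : KV n k => v.1) (fun v => ¬ v.2 = a) := by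
  classical
  intro τ _ hadj hP
  have : Nontrivial (Fin (k + 1)) := Fin.nontrivial_iff_two_le.2 (by omega)
  obtain ⟨b, hb⟩ := exists_ne a
  have key : ∀ i : Fin n, ∃ v : KV n k, v.1 = i ∧ ¬ v.2 = a ∧ ∀ w ∈ τ, w.1 = i → w = v := by
    intro i
    by_cases h : ∃ v ∈ τ, v.1 = i
    · obtain ⟨v, hv, hi⟩ := h
      refine ⟨v, hi, hP v hv, fun w hw hwi => ?_⟩
      by_contra hne
      exact hadj w hw v hv hne (hwi.trans hi.symm)
    · exact ⟨(i, b), rfl, hb, fun w hw hwi => (h ⟨w, hw, hwi⟩).elim⟩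
  choose f hf hfa hfτ using key
  refine ⟨f '' Set.univ, IsNClique.of_image (e := id) Set.finite_univ ?_
    (Set.injOn_id _) (fun i _ => hf i) (fun _ _ => Set.mem_univ _) ?_, ?_, ?_⟩
  · rw [Set.ncard_univ, Nat.card_fin]
  · intro i _ j _ hne
    show (f i).1 ≠ (f j).1
    rwa [hf, hf]
  · exact fun w hw => ⟨w.1, Set.mem_univ _, (hfτ w.1 w hw rfl).symm⟩
  · rintro _ ⟨i, -, rfl⟩
    exact hfa i

/-- The vertices of the original graph underlying a vertex of the subdivision. -/
def carrier {n : ℕ} : SubV V n → Set V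
  | Sum.inl v => {v}
  | Sum.inr p => p.2

theorem carrier_subset_of_mem_chiVerts {n : ℕ} {δ : V → Option O} {idv : V → Fin n} {σ : Set V}
    {x : SubV V n} (hx : x ∈ chiVerts n δ idv σ) : carrier x ⊆ σ := by
  rcases hx with ⟨v, hv, -, rfl⟩ | ⟨i, τ, hτ, -, rfl⟩
  · exact Set.singleton_subset_iff.2 hv
  · exact fun w hw => (hτ hw).1

theorem mem_chiVerts_of_carrier_subset {n : ℕ} {δ : V → Option O} {idv : V → Fin n}
    {σ ρ : Set V} {x : SubV V n} (hx : x ∈ chiVerts n δ idv σ) (h : carrier x ⊆ ρ) :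
    x ∈ chiVerts n δ idv ρ := by
  rcases hx with ⟨v, -, hδ, rfl⟩ | ⟨i, τ, hτ, hi, rfl⟩
  · exact Or.inl ⟨v, h rfl, hδ, rfl⟩
  · exact Or.inr ⟨i, τ, fun w hw => ⟨h hw, (hτ hw).2⟩, hi, rfl⟩

theorem CliquesExtend.chiGraph {n : ℕ} {G : PGraph V} {idv : V → Fin n} {P : V → Prop}
    (hG : CliquesExtend n G idv P) (δ : V → Option O) :
    CliquesExtend n (chiGraph n G δ idv) (subId n idv) (fun x => ∀ w ∈ carrier x, P w) := by
  classical
  intro τ hτ hadj hP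
  have hcommon : ∀ x ∈ τ, ∀ y ∈ τ, ∃ σ, IsNClique n G idv σ ∧
      x ∈ chiVerts n δ idv σ ∧ y ∈ chiVerts n δ idv σ := by
    intro x hx y hy
    by_cases hxy : x = y
    · subst hxy
      obtain ⟨σ, hσ, h⟩ := hτ hx
      exact ⟨σ, hσ, h, h⟩
    · obtain ⟨σ, hσ, h⟩ := hadj x hx y hy hxy
      exact ⟨σ, hσ, h.1, h.2.1⟩
  have hidτ : ∀ x ∈ τ, ∀ y ∈ τ, subId n idv x = subId n idv y → x = y := by
    intro x hx y hy h
    by_contra hxy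
    obtain ⟨σ, -, h'⟩ := hadj x hx y hy hxy
    exact h'.2.2.1 h
  obtain ⟨ρ, hρ, hSρ, hPρ⟩ := hG {v | ∃ x ∈ τ, v ∈ carrier x}
    (by
      rintro v ⟨x, hx, hv⟩
      obtain ⟨σ, hσ, h, -⟩ := hcommon x hx x hx
      exact hσ.1 (carrier_subset_of_mem_chiVerts h hv))
    (by
      rintro v ⟨x, hx, hv⟩ w ⟨y, hy, hw⟩ hne
      obtain ⟨σ, hσ, h, h'⟩ := hcommon x hx y hy
      exact hσ.2.2.2.1 v (carrier_subset_of_mem_chiVerts h hv) w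
        (carrier_subset_of_mem_chiVerts h' hw) hne)
    (by
      rintro v ⟨x, hx, hv⟩
      exact hP x hx v hv)
  have hτρ : ∀ x ∈ τ, x ∈ chiVerts n δ idv ρ := by
    intro x hx
    obtain ⟨σ, -, h, -⟩ := hcommon x hx x hx
    exact mem_chiVerts_of_carrier_subset h fun v hv => hSρ ⟨x, hx, hv⟩
  have key : ∀ v ∈ ρ, ∃ x ∈ chiVerts n δ idv ρ, subId n idv x = idv v ∧
      (∀ y ∈ τ, subId n idv y = idv v → y = x) ∧
      (x ∈ τ ∨ x = Sum.inl v ∨ x = Sum.inr (idv v, {w ∈ ρ | δ w = none})) := by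
    intro v hv
    by_cases h : ∃ x ∈ τ, subId n idv x = idv v
    · obtain ⟨x, hx, hxv⟩ := h
      exact ⟨x, hτρ x hx, hxv, fun y hy hyv => hidτ y hy x hx (hyv.trans hxv.symm), Or.inl hx⟩
    · by_cases hδ : δ v = none
      · exact ⟨Sum.inr (idv v, {w ∈ ρ | δ w = none}),
          Or.inr ⟨_, _, subset_rfl, ⟨v, ⟨hv, hδ⟩, rfl⟩, rfl⟩, rfl,
          fun y hy hyv => (h ⟨y, hy, hyv⟩).elim, Or.inr (Or.inr rfl)⟩
      · exact ⟨Sum.inl v, Or.inl ⟨v, hv, hδ, rfl⟩, rfl,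
          fun y hy hyv => (h ⟨y, hy, hyv⟩).elim, Or.inr (Or.inl rfl)⟩
  choose! f hfv hfid hfτ hfc using key
  refine ⟨f '' ρ, IsNClique.of_image (e := idv) hρ.2.1 hρ.2.2.1 hρ.2.2.2.2 hfid
    (fun v hv => ⟨ρ, hρ, hfv v hv⟩) ?_, ?_, ?_⟩
  · intro v hv w hw hne
    refine ⟨ρ, hρ, hfv v hv, hfv w hw, by rwa [hfid v hv, hfid w hw], ?_⟩
    have hne' : f v ≠ f w := fun h => hne (by rw [← hfid v hv, ← hfid w hw, h])
    have hv' := hfv v hv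
    have hw' := hfv w hw
    rcases hv' with ⟨v', -, -, h⟩ | ⟨i, α, hα, -, h⟩
    · exact Or.inl ⟨v', h⟩
    rcases hw' with ⟨w', -, -, h'⟩ | ⟨j, β, hβ, -, h'⟩
    · exact Or.inr (Or.inl ⟨w', h'⟩)
    rcases hfc v hv with hvτ | hvl | hvr
    · rcases hfc w hw with hwτ | hwl | hwr
      · obtain ⟨σ, -, h''⟩ := hadj _ hvτ _ hwτ hne'
        exact h''.2.2.2
      · exact Or.inr (Or.inl ⟨w, hwl⟩)
      · refine Or.inr (Or.inr ⟨i, α, _, _, h, hwr, Or.inl hα⟩)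
    · exact Or.inl ⟨v, hvl⟩
    · exact Or.inr (Or.inr ⟨_, _, j, β, hvr, h', Or.inr hβ⟩)
  · intro x hx
    have hid : ∃ v ∈ ρ, subId n idv x = idv v := by
      rcases hτρ x hx with ⟨v, hv, -, rfl⟩ | ⟨i, α, hα, ⟨w, hw, rfl⟩, rfl⟩
      · exact ⟨v, hv, rfl⟩
      · exact ⟨w, (hα hw).1, rfl⟩
    obtain ⟨v, hv, h⟩ := hid
    exact ⟨v, hv, (hfτ v hv x hx h).symm⟩
  · rintro _ ⟨v, hv, rfl⟩ w hw
    exact hPρ w (carrier_subset_of_mem_chiVerts (hfv v hv) hw)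

theorem not_seen_succ_iff {n k t : ℕ} {a : Fin (k + 1)} (x : IterV (KV n k) n (t + 1)) :
    ¬ seen n k (t + 1) x a ↔
      ∀ w ∈ carrier (V := IterV (KV n k) n t) (n := n) x, ¬ seen n k t w a := by
  rcases x with v | p
  · exact ⟨fun h w hw => by rw [Set.mem_singleton_iff.1 hw]; exact h, fun h => h v rfl⟩
  · exact ⟨fun h w hw hs => h ⟨w, hw, hs⟩, fun h ⟨w, hw, hs⟩ => h w hw hs⟩

theorem cliquesExtend_iterate {n k : ℕ} (hk : 1 ≤ k)
    (G : ∀ t, PGraph (IterV (KV n k) n t))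
    (δ : ∀ t, IterV (KV n k) n t → Option (Fin (k + 1)))
    (hG0 : G 0 = G0 n k)
    (hGrec : ∀ t, G (t + 1) = chiGraph n (G t) (δ t) (iterId n (fun v : KV n k => v.1) t))
    (t : ℕ) (a : Fin (k + 1)) :
    CliquesExtend n (G t) (iterId n (fun v : KV n k => v.1) t) (fun w => ¬ seen n k t w a) := by
  induction t with
  | zero =>
    rw [hG0]
    exact cliquesExtend_G0 hk a
  | succ t ih =>
    rw [hGrec, funext fun x => propext (not_seen_succ_iff (a := a) x)]
    exact ih.chiGraph (δ t)

/-- In the iterated construction for `k`-set agreement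
inputs, for every `t ≥ 0`, every input value `a ∈ {0,…,k}`, and every subset
`τ` of an `n`-vertex clique of `𝔾_t` such that no vertex of `τ` has seen `a`,
there exists an `n`-vertex clique of `N_t(a)` that contains `τ`. -/
theorem unseen_subset_extends_to_clique {n k : ℕ} (hn : 2 ≤ n) (hk : 1 ≤ k)
    (G : ∀ t, PGraph (IterV (KV n k) n t))
    (δ : ∀ t, IterV (KV n k) n t → Option (Fin (k + 1)))
    (hG0 : G 0 = G0 n k)
    (hGrec : ∀ t, G (t + 1) = chiGraph n (G t) (δ t) (iterId n (fun v : KV n k => v.1) t))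
    (hδ : ∀ (t : ℕ) (v : IterV (KV n k) n t), δ t v ≠ none → δ (t + 1) (Sum.inl v) = δ t v) :
    ∀ (t : ℕ) (a : Fin (k + 1)) (σ τ : Set (IterV (KV n k) n t)),
      IsNClique n (G t) (iterId n (fun v : KV n k => v.1) t) σ → τ ⊆ σ →
      (∀ w ∈ τ, ¬ seen n k t w a) →
      ∃ ρ, IsNClique n (G t) (iterId n (fun v : KV n k => v.1) t) ρ ∧
        ρ ⊆ Nset n k G t a ∧ τ ⊆ ρ := by
  intro t a σ τ hσ hτσ hτ
  obtain ⟨ρ, hρ, hτρ, hρa⟩ := cliquesExtend_iterate hk G δ hG0 hGrec t a τ (hτσ.trans hσ.1)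
    (fun u hu v hv => hσ.2.2.2.1 u (hτσ hu) v (hτσ hv)) hτ
  exact ⟨ρ, hρ, fun x hx => ⟨ρ, hρ, hρa, hx⟩, hτρ⟩

end EBP
end

section
/- Let G be a graph with a status function δ, for each output value c let T(c) := {v : δ(v) = c}, let a and b be distinct output values, and let N be a set of vertices of G. Assume: (i) if T(a) and N are both nonempty, then the distance between T(a) and N in G is at least 2; and (ii) for every output value c ≠ a such that T(a) and T(c) are both nonempty, the distance between T(a) and T(c) in G is at least 3. Then every path in G from a vertex of T(a) to a vertex of N ∪ T(b) contains at least one edge both of whose endpoints are active. -/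
set_option linter.dupNamespace false

namespace EBP

variable {V O : Type}

/-- The set of terminated vertices of `G` with output `c`. -/
def TsetG {V O : Type} (G : PGraph V) (δ : V → Option O) (c : O) : Set V :=
  {v | v ∈ G.verts ∧ δ v = some c}

theorem IsWalkBetween.lt_length {V : Type} {G : PGraph V} {A B : Set V} {l : List V} {k : ℕ}
    (hl : IsWalkBetween G A B l) (hk : (k : ℕ∞) ≤ setDist G A B) : k < l.length := by
  have hpos : 0 < l.length := List.length_pos_of_ne_nil hl.2.2.1
  have hle : setDist G A B ≤ ((l.length - 1 : ℕ) : ℕ∞) := by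
    refine sInf_le ⟨l, hl, ?_⟩
    norm_cast
    omega
  have : k ≤ l.length - 1 := by exact_mod_cast hk.trans hle
  omega

/-- Let `G` be a graph with a status function `δ`, for each
output value `c` let `T(c) := {v : δ(v) = c}`, let `a` and `b` be distinct
output values, and let `N` be a set of vertices of `G`. Assume: (i) if `T(a)`
and `N` are both nonempty, then the distance between `T(a)` and `N` in `G` is
at least 2; and (ii) for every output value `c ≠ a` such that `T(a)` and `T(c)`
are both nonempty, the distance between `T(a)` and `T(c)` in `G` is at least 3.
Then every path in `G` from a vertex of `T(a)` to a vertex of `N ∪ T(b)`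
contains at least one edge both of whose endpoints are active. -/
theorem walk_to_N_or_Tb_has_active_edge {V O : Type}
    (G : PGraph V) (δ : V → Option O) (a b : O) (hab : a ≠ b)
    (N : Set V) (hN : N ⊆ G.verts)
    (h2 : (TsetG G δ a).Nonempty → N.Nonempty → 2 ≤ setDist G (TsetG G δ a) N)
    (h3 : ∀ c : O, c ≠ a → (TsetG G δ a).Nonempty → (TsetG G δ c).Nonempty →
      3 ≤ setDist G (TsetG G δ a) (TsetG G δ c)) :
    ∀ l, IsWalkBetween G (TsetG G δ a) (N ∪ TsetG G δ b) l → HasActiveEdge δ l := by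
  have far : ∀ c, c ≠ a → ∀ l, IsWalkBetween G (TsetG G δ a) (TsetG G δ c) l →
      3 < l.length := fun c hc l hl =>
    hl.lt_length (k := 3) (h3 c hc ⟨_, hl.2.2.2.1⟩ ⟨_, hl.2.2.2.2⟩)
  have farN : ∀ l, IsWalkBetween G (TsetG G δ a) N l → 2 < l.length := fun l hl =>
    hl.lt_length (k := 2) (h2 ⟨_, hl.2.2.2.1⟩ ⟨_, hl.2.2.2.2⟩)
  have cons : ∀ (x : V) (l : List V), HasActiveEdge δ l → HasActiveEdge δ (x :: l) := by
    rintro x l ⟨l₁, l₂, u, v, rfl, hu, hv⟩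
    exact ⟨x :: l₁, l₂, u, v, rfl, hu, hv⟩
  intro l
  induction hn : l.length using Nat.strong_induction_on generalizing l with
  | _ n ih =>
  subst hn
  rintro ⟨hc, hm, hne, hA, hB⟩
  match l, hc, hm, hne, hA, hB with
  | [x], hc, hm, _, hA, hB =>
    rcases hB with hB | hB
    · simpa using farN [x] ⟨hc, hm, by simp, hA, hB⟩
    · simpa using far b hab.symm [x] ⟨hc, hm, by simp, hA, hB⟩
  | x :: y :: t, hc, hm, _, hA, hB =>
    obtain ⟨hxy, hyt⟩ := List.isChain_cons_cons.1 hc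
    have hmy : ∀ v ∈ y :: t, v ∈ G.verts := fun v hv => hm v (List.mem_cons_of_mem _ hv)
    have hBy : (y :: t).getLast (by simp) ∈ N ∪ TsetG G δ b := by simpa using hB
    cases hy : δ y with
    | some c =>
      by_cases hca : c = a
      · subst hca
        exact cons _ _ (ih (y :: t).length (by simp) _ rfl
          ⟨hyt, hmy, by simp, ⟨hmy y (by simp), hy⟩, hBy⟩)
      · have := far c hca [x, y]
          ⟨List.isChain_pair.2 hxy, by simp_all, by simp, hA, hmy y (by simp), hy⟩
        simp at this
    | none =>
      clear hB
      match t, hc, hm, hyt, hmy, hBy with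
      | [], hc, hm, _, _, hBy =>
        rcases hBy with hB | hB
        · simpa using farN [x, y] ⟨hc, hm, by simp, hA, hB⟩
        · simpa using far b hab.symm [x, y] ⟨hc, hm, by simp, hA, hB⟩
      | z :: t, hc, hm, hyt, hmy, hBy =>
        obtain ⟨hyz, hzt⟩ := List.isChain_cons_cons.1 hyt
        have hmz : ∀ v ∈ z :: t, v ∈ G.verts := fun v hv => hmy v (List.mem_cons_of_mem _ hv)
        cases hz : δ z with
        | none => exact ⟨[x], t, y, z, rfl, hy, hz⟩
        | some c =>
          by_cases hca : c = a
          · subst hca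
            exact cons _ _ (cons _ _ (ih (z :: t).length (by simp) _ rfl
              ⟨hzt, hmz, by simp, ⟨hmz z (by simp), hz⟩, by simpa using hBy⟩))
          · have := far c hca [x, y, z]
              ⟨List.isChain_cons_cons.2 ⟨hxy, List.isChain_pair.2 hyz⟩, by simp_all, by simp, hA,
                hmz z (by simp), hz⟩
            simp at this

end EBP
end

section
/- Let C be a configuration of an NIS protocol in which every active process is poised to perform an update to S_t, let C′ be a configuration reachable from C (i.e., C′ = Cα for some finite schedule α from C), let r ≥ 1, and let P be a set of processes each of which, in C′, is either poised to perform an update to S_{t+r} or has terminated before performing an update to S_{t+r}. Then there exists an r-round schedule β from C such that Cβ and C′ are indistinguishable to P. -/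
set_option linter.dupNamespace false

namespace EBP

/-- States of a process in the NIS model: its initial state `(i, x)`, the state
after performing an `update` (the previous state plus a bit recording the
update), and the state `(i, r, v)` after a `scan` of the snapshot object `S_r`,
where `v` is the result of the scan. -/
inductive PState (n : ℕ) (I : Type) : Type where
  | init : Fin n → I → PState n I
  | upd : PState n I → PState n I
  | scanned : Fin n → ℕ → (Fin n → Option (PState n I)) → PState n I

namespace PState

/-- The identifier of the process whose state this is. -/
def pid {n : ℕ} {I : Type} : PState n I → Fin n
  | init i _ => i
  | upd s => pid s
  | scanned i _ _ => i

/-- The index of the next snapshot object this state is due to update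
(the number of completed scans). -/
def rounds {n : ℕ} {I : Type} : PState n I → ℕ
  | init _ _ => 0
  | upd s => rounds s
  | scanned _ r _ => r + 1

/-- Whether the state has performed its `update` to its current snapshot object
but not yet its `scan`. -/
def hasUpd {n : ℕ} {I : Type} : PState n I → Bool
  | upd _ => true
  | _ => false

/-- Whether this state is the result of a `scan`. -/
def isScanned {n : ℕ} {I : Type} : PState n I → Bool
  | scanned _ _ _ => true
  | _ => false

end PState

/-- A configuration: the contents of each component of each snapshot object
(`mem r i` is component `i` of `S_r`), and the state of each process. -/
structure Config (n : ℕ) (I : Type) where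
  mem : ℕ → Fin n → Option (PState n I)
  st : Fin n → PState n I

/-- The initial configuration with input `x i` for process `i`. -/
def initConfig {n : ℕ} {I : Type} (x : Fin n → I) : Config n I where
  mem := fun _ _ => none
  st := fun i => PState.init i (x i)

/-- One step of process `i`: an `update` writing its current state to its
snapshot object if it has not updated it yet, and otherwise a `scan`. -/
def stepc {n : ℕ} {I : Type} (C : Config n I) (i : Fin n) : Config n I :=
  match C.st i with
  | PState.upd s =>
      { C with st := Function.update C.st i (PState.scanned i s.rounds (C.mem s.rounds)) }
  | s =>
      { mem := Function.update C.mem s.rounds (Function.update (C.mem s.rounds) i (some s)),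
        st := Function.update C.st i (PState.upd s) }

/-- Running a schedule from a configuration. -/
def runSched {n : ℕ} {I : Type} (C : Config n I) : List (Fin n) → Config n I
  | [] => C
  | i :: l => runSched (stepc C i) l

/-- `l` is a schedule from `C` for the protocol `δ`: every process is active
(has not terminated) when it takes its step. -/
def IsSched {n : ℕ} {I O : Type} (δ : PState n I → Option O) :
    Config n I → List (Fin n) → Prop
  | _, [] => True
  | C, i :: l => δ (C.st i) = none ∧ IsSched δ (stepc C i) l

/-- `l` is a 1-round schedule from `C`: a schedule consisting of exactly two
occurrences of each process that is active in `C`. -/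
def IsOneRound {n : ℕ} {I O : Type} (δ : PState n I → Option O) (C : Config n I)
    (l : List (Fin n)) : Prop :=
  IsSched δ C l ∧ ∀ i, l.count i = if (δ (C.st i)).isNone then 2 else 0

/-- `l` is an `r`-round schedule from `C`. -/
def IsRounds {n : ℕ} {I O : Type} (δ : PState n I → Option O) :
    Config n I → ℕ → List (Fin n) → Prop
  | _, 0, l => l = []
  | C, r + 1, l => ∃ l₁ l₂, l = l₁ ++ l₂ ∧ IsOneRound δ C l₁ ∧ IsRounds δ (runSched C l₁) r l₂

/-- Process `i` is poised to perform an `update` to the snapshot object `S_r`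
in configuration `C`. -/
def PoisedUpdate {n : ℕ} {I : Type} (C : Config n I) (i : Fin n) (r : ℕ) : Prop :=
  (C.st i).hasUpd = false ∧ (C.st i).rounds = r

/-- Twice the number of completed scans, plus one if an `update` is pending its `scan`. -/
def PState.progress {n : ℕ} {I : Type} (s : PState n I) : ℕ :=
  2 * s.rounds + s.hasUpd.toNat

theorem PState.hasUpd_eq_false_of_isScanned {n : ℕ} {I : Type} {s : PState n I}
    (h : s.isScanned = true) : s.hasUpd = false := by
  cases s <;> simp_all [isScanned, hasUpd]

section Steps

variable {n : ℕ} {I O : Type}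

theorem stepc_st_of_ne (C : Config n I) {i j : Fin n} (h : j ≠ i) :
    (stepc C i).st j = C.st j := by
  unfold stepc
  split <;> simp [h]

theorem stepc_mem_of_ne (C : Config n I) (i : Fin n) {q : ℕ} (h : q ≠ (C.st i).rounds) :
    (stepc C i).mem q = C.mem q := by
  unfold stepc
  split <;> simp [h]

theorem progress_stepc_self (C : Config n I) (i : Fin n) :
    ((stepc C i).st i).progress = (C.st i).progress + 1 := by
  unfold stepc
  rcases h : C.st i with _ | _ | _ <;>
    (simp [PState.progress, PState.rounds, PState.hasUpd]; try ring)

theorem stepc_st_congr {C D : Config n I} {i : Fin n} (hst : C.st i = D.st i)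
    (hmem : C.mem (C.st i).rounds = D.mem (C.st i).rounds) :
    (stepc C i).st i = (stepc D i).st i := by
  unfold stepc
  rw [← hst]
  split
  next s h =>
    rw [h, PState.rounds] at hmem
    simp [hmem]
  next => simp

theorem stepc_mem_congr {C D : Config n I} {i : Fin n} {q : ℕ} (hst : C.st i = D.st i)
    (hmem : C.mem q = D.mem q) : (stepc C i).mem q = (stepc D i).mem q := by
  unfold stepc
  rw [← hst]
  split
  · exact hmem
  · simp only [Function.update_apply]
    split_ifs with h
    · rw [← h, hmem]
    · exact hmem

theorem runSched_append (C : Config n I) (l m : List (Fin n)) :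
    runSched C (l ++ m) = runSched (runSched C l) m := by
  induction l generalizing C with
  | nil => rfl
  | cons i l ih => exact ih _

theorem isSched_append {δ : PState n I → Option O} {C : Config n I} {l m : List (Fin n)} :
    IsSched δ C (l ++ m) ↔ IsSched δ C l ∧ IsSched δ (runSched C l) m := by
  induction l generalizing C with
  | nil => simp [IsSched, runSched]
  | cons i l ih => simp [IsSched, runSched, ih, and_assoc]

theorem runSched_st_of_notMem (C : Config n I) {l : List (Fin n)} {i : Fin n} (h : i ∉ l) :
    (runSched C l).st i = C.st i := by
  induction l generalizing C with
  | nil => rfl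
  | cons j l ih =>
    rw [List.mem_cons, not_or] at h
    exact (ih _ h.2).trans (stepc_st_of_ne C h.1)

theorem progress_runSched (C : Config n I) (l : List (Fin n)) (i : Fin n) :
    ((runSched C l).st i).progress = (C.st i).progress + l.count i := by
  induction l generalizing C with
  | nil => rfl
  | cons j l ih =>
    rw [runSched, ih, List.count_cons]
    rcases eq_or_ne i j with rfl | h
    · rw [progress_stepc_self]; simp; ring
    · simp [stepc_st_of_ne C h, h.symm]

theorem runSched_mem_of_progress_le (C : Config n I) {l : List (Fin n)} {t q : ℕ} (hq : t < q)
    (h : ∀ i ∈ l, (C.st i).progress + l.count i ≤ 2 * t + 2) :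
    (runSched C l).mem q = C.mem q := by
  induction l generalizing C with
  | nil => rfl
  | cons j l ih =>
    rw [runSched, ih]
    · apply stepc_mem_of_ne
      have := h j (by simp)
      simp only [List.count_cons_self, PState.progress] at this
      omega
    · intro i hi
      have := h i (by simp [hi])
      rcases eq_or_ne i j with rfl | hij
      · rw [progress_stepc_self]; simp at this; omega
      · rw [stepc_st_of_ne C hij]; simpa [List.count_cons, hij.symm] using this

/-- A terminated process takes no step in a schedule. -/
theorem IsSched.notMem {δ : PState n I → Option O} {C : Config n I} {l : List (Fin n)}
    {i : Fin n} (hl : IsSched δ C l) (hi : δ (C.st i) ≠ none) : i ∉ l := by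
  induction l generalizing C with
  | nil => simp
  | cons j l ih =>
    have hij : i ≠ j := by rintro rfl; exact hi hl.1
    rw [List.mem_cons, not_or]
    exact ⟨hij, ih hl.2 (by rwa [stepc_st_of_ne C hij])⟩

/-- The steps of `l`, performed from `C`, that access `S_0, …, S_t`. -/
def earlySteps (t : ℕ) : Config n I → List (Fin n) → List (Fin n)
  | _, [] => []
  | C, i :: l =>
    if (C.st i).rounds ≤ t then i :: earlySteps t (stepc C i) l else earlySteps t (stepc C i) l

/-- The steps of `l`, performed from `C`, that access snapshot objects after `S_t`. -/
def lateSteps (t : ℕ) : Config n I → List (Fin n) → List (Fin n)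
  | _, [] => []
  | C, i :: l =>
    if (C.st i).rounds ≤ t then lateSteps t (stepc C i) l else i :: lateSteps t (stepc C i) l

theorem mem_of_mem_lateSteps {t : ℕ} {C : Config n I} {l : List (Fin n)} {i : Fin n}
    (h : i ∈ lateSteps t C l) : i ∈ l := by
  induction l generalizing C with
  | nil => exact h
  | cons j l ih => grind [lateSteps]

theorem count_earlySteps_le (t : ℕ) (C : Config n I) (l : List (Fin n)) (i : Fin n) :
    (earlySteps t C l).count i ≤ 2 * t + 2 - (C.st i).progress := by
  induction l generalizing C with
  | nil => simp [earlySteps]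
  | cons j l ih =>
    have := ih (stepc C j)
    rcases eq_or_ne i j with rfl | hij
    · rw [progress_stepc_self] at this
      have hb := Bool.toNat_le (C.st i).hasUpd
      rw [earlySteps]
      split_ifs with hr
      · rw [List.count_cons_self]
        simp only [PState.progress] at *
        omega
      · omega
    · rw [stepc_st_of_ne C hij] at this
      rw [earlySteps]
      split_ifs
      · rwa [List.count_cons_of_ne hij.symm]
      · exact this

theorem notMem_earlySteps {t : ℕ} {C : Config n I} {i : Fin n} (h : t < (C.st i).rounds)
    (l : List (Fin n)) : i ∉ earlySteps t C l := by
  have := count_earlySteps_le t C l i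
  rw [← List.count_eq_zero]
  simp only [PState.progress] at this
  omega

/-- The early steps of a schedule from `C` can be performed from any `D` that agrees with `C` on
what is relevant up to `S_t`, and the late steps from any `E` that agrees with `C` on what is
relevant after `S_t` and where the other processes are as the early steps leave them. -/
theorem isSched_early_late {δ : PState n I → Option O} {t : ℕ} {l : List (Fin n)}
    {C D E : Config n I} (hl : IsSched δ C l)
    (hDmem : ∀ q ≤ t, D.mem q = C.mem q)
    (hDst : ∀ i, (C.st i).rounds ≤ t → D.st i = C.st i)
    (hEmem : ∀ q, t < q → E.mem q = C.mem q)
    (hEst : ∀ i, t < (C.st i).rounds → E.st i = C.st i)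
    (hE : ∀ i, (C.st i).rounds ≤ t → t < ((runSched D (earlySteps t C l)).st i).rounds →
      E.st i = (runSched D (earlySteps t C l)).st i) :
    IsSched δ D (earlySteps t C l) ∧ IsSched δ E (lateSteps t C l) ∧
      ∀ i, t < ((runSched C l).st i).rounds →
        (runSched E (lateSteps t C l)).st i = (runSched C l).st i := by
  induction l generalizing C D E with
  | nil => exact ⟨trivial, trivial, hEst⟩
  | cons j l ih =>
    by_cases hj : (C.st j).rounds ≤ t
    · simp only [earlySteps, lateSteps, if_pos hj, IsSched, runSched] at hE ⊢
      have hDj := hDst j hj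
      have hself : (stepc D j).st j = (stepc C j).st j :=
        stepc_st_congr hDj (hDmem _ (by rwa [hDj]))
      rw [hDj, and_assoc]
      refine ⟨hl.1, ih hl.2 ?_ ?_ ?_ ?_ ?_⟩
      · exact fun q hq => stepc_mem_congr hDj (hDmem q hq)
      · intro i hi
        rcases eq_or_ne i j with rfl | hij
        · exact hself
        · rw [stepc_st_of_ne _ hij] at hi ⊢
          rw [stepc_st_of_ne _ hij, hDst i hi]
      · intro q hq
        rw [stepc_mem_of_ne _ _ (by omega), hEmem q hq]
      · intro i hi
        rcases eq_or_ne i j with rfl | hij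
        · have hrun := runSched_st_of_notMem (stepc D i) (notMem_earlySteps hi l)
          rw [hE i hj (by rwa [hrun, hself]), hrun, hself]
        · rw [stepc_st_of_ne _ hij] at hi ⊢
          exact hEst i hi
      · intro i hi hi'
        rcases eq_or_ne i j with rfl | hij
        · exact hE i hj hi'
        · rw [stepc_st_of_ne _ hij] at hi
          exact hE i hi hi'
    · simp only [earlySteps, lateSteps, if_neg hj, IsSched, runSched] at hE ⊢
      rw [not_le] at hj
      have hEj := hEst j hj
      have hself : (stepc E j).st j = (stepc C j).st j :=
        stepc_st_congr hEj (hEmem _ (by rwa [hEj]))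
      have hrounds : t < ((stepc C j).st j).rounds := by
        have := progress_stepc_self C j
        have hb := Bool.toNat_le ((stepc C j).st j).hasUpd
        simp only [PState.progress] at this
        omega
      rw [hEj]
      rw [and_assoc, and_left_comm]
      refine ⟨hl.1, ih hl.2 ?_ ?_ ?_ ?_ ?_⟩
      · intro q hq
        rw [stepc_mem_of_ne _ _ (by omega), hDmem q hq]
      · intro i hi
        have hij : i ≠ j := by rintro rfl; omega
        rw [stepc_st_of_ne _ hij] at hi ⊢
        exact hDst i hi
      · exact fun q hq => stepc_mem_congr hEj (hEmem q hq)
      · intro i hi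
        rcases eq_or_ne i j with rfl | hij
        · exact hself
        · rw [stepc_st_of_ne _ hij] at hi ⊢
          rw [stepc_st_of_ne _ hij, hEst i hi]
      · intro i hi hi'
        have hij : i ≠ j := by rintro rfl; omega
        rw [stepc_st_of_ne _ hij] at hi ⊢
        exact hE i hi hi'

theorem PoisedUpdate.progress_eq {C : Config n I} {i : Fin n} {t : ℕ}
    (h : PoisedUpdate C i t) : (C.st i).progress = 2 * t := by
  simp [PState.progress, h.1, h.2]

theorem poisedUpdate_of_progress_eq {C : Config n I} {i : Fin n} {t : ℕ}
    (h : (C.st i).progress = 2 * t) : PoisedUpdate C i t := by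
  unfold PState.progress at h
  unfold PoisedUpdate
  cases hu : (C.st i).hasUpd <;> simp [hu] at h ⊢ <;> omega

/-- A schedule in which every process takes at most two steps extends to a 1-round schedule. -/
theorem exists_isOneRound_append {δ : PState n I → Option O}
    (hδ : ∀ s : PState n I, δ s ≠ none → s.isScanned = true) {C : Config n I} {t : ℕ}
    (hpoised : ∀ i, δ (C.st i) = none → PoisedUpdate C i t) (l : List (Fin n))
    (hl : IsSched δ C l) (hcount : ∀ i, l.count i ≤ 2) :
    ∃ m, IsOneRound δ C (l ++ m) := by
  by_cases hex : ∃ i, δ (C.st i) = none ∧ l.count i < 2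
  · obtain ⟨i, hi, hlt⟩ := hex
    have hact : δ ((runSched C l).st i) = none := by
      rcases Nat.eq_zero_or_pos (l.count i) with h0 | hpos
      · rwa [runSched_st_of_notMem C (List.count_eq_zero.1 h0)]
      · by_contra hne
        have hp := progress_runSched C l i
        rw [(hpoised i hi).progress_eq, PState.progress,
          PState.hasUpd_eq_false_of_isScanned (hδ _ hne), Bool.toNat_false] at hp
        omega
    have hcount' : ∀ j, (l ++ [i]).count j ≤ 2 := by
      intro j
      have := hcount j
      rcases eq_or_ne i j with rfl | hij
      · simp; omega
      · simpa [hij] using this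
    obtain ⟨m, hm⟩ := exists_isOneRound_append hδ hpoised (l ++ [i])
      (isSched_append.2 ⟨hl, hact, trivial⟩) hcount'
    exact ⟨i :: m, by simpa using hm⟩
  · refine ⟨[], by simpa using hl, fun i => ?_⟩
    rw [List.append_nil]
    by_cases hi : δ (C.st i) = none
    · have := hcount i
      have : ¬ l.count i < 2 := fun h => hex ⟨i, hi, h⟩
      simp [hi]; omega
    · rw [List.count_eq_zero.2 (hl.notMem hi), if_neg (by simpa using hi)]
termination_by ∑ i, (2 - l.count i)
decreasing_by
  refine Finset.sum_lt_sum (fun j _ => ?_) ⟨i, Finset.mem_univ i, ?_⟩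
  · rw [List.count_append]; omega
  · simp; omega

theorem notMem_of_progress_le {δ : PState n I → Option O} {C : Config n I} {t : ℕ}
    (hpoised : ∀ i, δ (C.st i) = none → PoisedUpdate C i t) {l : List (Fin n)}
    (hl : IsSched δ C l) {i : Fin n} (hi : ((runSched C l).st i).progress ≤ 2 * t) : i ∉ l := by
  by_cases hact : δ (C.st i) = none
  · have hp := progress_runSched C l i
    rw [(hpoised i hact).progress_eq] at hp
    exact List.count_eq_zero.1 (by omega)
  · exact hl.notMem hact

theorem PState.progress_eq_of_isScanned {s : PState n I} (h : s.isScanned = true) :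
    s.progress = 2 * s.rounds := by
  rw [progress, hasUpd_eq_false_of_isScanned h, Bool.toNat_false, add_zero]

/-- The statement of `round_schedule_indistinguishable`, with zero rounds allowed. -/
theorem exists_isRounds_st_eq {δ : PState n I → Option O}
    (hδ : ∀ s : PState n I, δ s ≠ none → s.isScanned = true) (r : ℕ) {C : Config n I} {t : ℕ}
    (hpoised : ∀ i, δ (C.st i) = none → PoisedUpdate C i t)
    {α : List (Fin n)} (hα : IsSched δ C α) {P : Set (Fin n)}
    (hP : ∀ i ∈ P,
      (δ ((runSched C α).st i) = none ∧ PoisedUpdate (runSched C α) i (t + r)) ∨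
        (δ ((runSched C α).st i) ≠ none ∧ ((runSched C α).st i).rounds ≤ t + r)) :
    ∃ β, IsRounds δ C r β ∧ ∀ i ∈ P, (runSched C β).st i = (runSched C α).st i := by
  induction r generalizing C t α with
  | zero =>
    refine ⟨[], rfl, fun i hi => (runSched_st_of_notMem C 
      (notMem_of_progress_le hpoised hα ?_)).symm⟩
    rcases hP i hi with h | h
    · exact h.2.progress_eq.le
    · rw [PState.progress_eq_of_isScanned (hδ _ h.1)]
      omega
  | succ r ih =>
    have hrounds : ∀ i, t < (C.st i).rounds → δ (C.st i) ≠ none := by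
      intro i hi hact
      have := (hpoised i hact).2
      omega
    obtain ⟨hearly, -, -⟩ := isSched_early_late (t := t) (D := C)
      (E := ⟨C.mem, fun i => if t < (C.st i).rounds then C.st i else
        (runSched C (earlySteps t C α)).st i⟩) hα
      (fun _ _ => rfl) (fun _ _ => rfl) (fun _ _ => rfl) (fun i hi => if_pos hi)
      (fun i hi _ => if_neg (not_lt.2 hi))
    have hcount : ∀ i, (earlySteps t C α).count i ≤ 2 := by
      intro i
      by_cases hact : δ (C.st i) = none
      · have := count_earlySteps_le t C α i
        rw [(hpoised i hact).progress_eq] at this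
        omega
      · rw [List.count_eq_zero.2 (hearly.notMem hact)]; omega
    obtain ⟨m, hm⟩ := exists_isOneRound_append hδ hpoised _ hearly hcount
    set β := earlySteps t C α ++ m with hβ
    have hβprogress : ∀ i, δ (C.st i) = none →
        ((runSched C β).st i).progress = 2 * (t + 1) := by
      intro i hact
      rw [progress_runSched, (hpoised i hact).progress_eq, hm.2 i, hact]
      simp; ring
    obtain ⟨-, hlate, hst⟩ := isSched_early_late (t := t) (D := C) (E := runSched C β) hα
      (fun _ _ => rfl) (fun _ _ => rfl)
      (fun q hq => by
        refine runSched_mem_of_progress_le C hq fun i hi => ?_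
        by_cases hact : δ (C.st i) = none
        · rw [← progress_runSched, hβprogress i hact, mul_add]
        · exact absurd hi (hm.1.notMem hact))
      (fun i hi => runSched_st_of_notMem C (hm.1.notMem (hrounds i hi)))
      (fun i hi hi' => by
        by_cases hact : δ (C.st i) = none
        · rw [hβ, runSched_append]
          apply runSched_st_of_notMem
          have hc := hm.2 i
          have hp := progress_runSched C (earlySteps t C α) i
          rw [(hpoised i hact).progress_eq] at hp
          simp only [PState.progress] at hp
          simp only [hβ, List.count_append, hact, Option.isNone_none, if_true] at hc
          exact List.count_eq_zero.1 (by omega)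
        · rw [runSched_st_of_notMem C (hm.1.notMem hact),
            runSched_st_of_notMem C (hearly.notMem hact)])
    have hagree : ∀ i ∈ P, (runSched (runSched C β) (lateSteps t C α)).st i =
        (runSched C α).st i := by
      intro i hi
      by_cases ht : t < ((runSched C α).st i).rounds
      · exact hst i ht
      · rcases hP i hi with h | h
        · have := h.2.2
          omega
        · have hnot := notMem_of_progress_le hpoised hα
            (i := i) (by rw [PState.progress_eq_of_isScanned (hδ _ h.1)]; omega)
          rw [runSched_st_of_notMem C hnot] at h ⊢
          rw [runSched_st_of_notMem _ (fun hmem => hnot (mem_of_mem_lateSteps hmem)),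
            runSched_st_of_notMem C (hm.1.notMem h.1)]
    obtain ⟨γ, hγ, hγst⟩ := ih (C := runSched C β) (t := t + 1) (α := lateSteps t C α)
      (fun i hact => by
        by_cases hi : δ (C.st i) = none
        · exact poisedUpdate_of_progress_eq (hβprogress i hi)
        · rw [runSched_st_of_notMem C (hm.1.notMem hi)] at hact
          exact absurd hact hi)
      hlate
      (fun i hi => by
        have h := hP i hi
        rwa [PoisedUpdate, ← hagree i hi, ← PoisedUpdate, Nat.add_comm r 1, ← add_assoc] at h)
    refine ⟨β ++ γ, ⟨β, γ, rfl, hm, hγ⟩, fun i hi => ?_⟩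
    rw [runSched_append, hγst i hi, hagree i hi]

end Steps

/-- Let `C` be a configuration of an NIS protocol in which
every active process is poised to perform an `update` to `S_t`, let `C′` be a
configuration reachable from `C`, let `r ≥ 1`, and let `P` be a set of
processes each of which, in `C′`, is either poised to perform an `update` to
`S_{t+r}` or has terminated before performing an `update` to `S_{t+r}`. Then
there exists an `r`-round schedule `β` from `C` such that `Cβ` and `C′` are
indistinguishable to `P`. -/
theorem round_schedule_indistinguishable {n : ℕ} {I O : Type}
    (δ : PState n I → Option O)
    (hδ : ∀ s : PState n I, δ s ≠ none → s.isScanned = true)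
    (C : Config n I) (t r : ℕ) (hr : 1 ≤ r)
    (hpoised : ∀ i, δ (C.st i) = none → PoisedUpdate C i t)
    (α : List (Fin n)) (hα : IsSched δ C α)
    (P : Set (Fin n))
    (hP : ∀ i ∈ P,
      (δ ((runSched C α).st i) = none ∧ PoisedUpdate (runSched C α) i (t + r)) ∨
        (δ ((runSched C α).st i) ≠ none ∧ ((runSched C α).st i).rounds ≤ t + r)) :
    ∃ β, IsRounds δ C r β ∧ ∀ i ∈ P, (runSched C β).st i = (runSched C α).st i := by
  exact exists_isRounds_st_eq hδ r hpoised hα hP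

end EBP
end

section
/- Let σ be an n-vertex clique that represents a configuration C of an NIS protocol in which every active process is poised to update the snapshot object S_{t+1}. If β is a 1-round schedule from C, then the configuration Cβ is represented by an n-vertex clique of χ(σ,δ). -/
set_option linter.dupNamespace false

namespace EBP

variable {V O : Type}

/-- An `n`-vertex clique (a set of `n` process states) represents a
configuration if its vertices are exactly the states of the `n` processes in
that configuration. -/
def Represents {n : ℕ} {I : Type} (σ : Set (PState n I)) (C : Config n I) : Prop :=
  σ = Set.range C.st ∧ ∀ i, (C.st i).pid = i

open Classical in
/-- The identification of a subdivision vertex with a process state: an old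
(terminated) vertex is identified with itself, and a pair `(i, τ)` is
identified with the state of process `p_i` consisting of `i` and the scan
result of `S_t` whose component `j` is the state represented by the vertex of
`τ` with identifier `j` for each `j ∈ id(τ)`, and `−` (i.e. `none`) for
`j ∉ id(τ)`. -/
noncomputable def embedSub {n : ℕ} {I : Type} (t : ℕ) :
    SubV (PState n I) n → PState n I :=
  Sum.elim id (fun p =>
    PState.scanned p.1 t
      (fun j => if h : ∃ w ∈ p.2, PState.pid w = j then some h.choose else none))

open Classical in
/-- The vector of components of a snapshot object that has been updated by exactly the
processes in `U`, where process `j` wrote `s j`. -/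
noncomputable def view {n : ℕ} {I : Type} (s : Fin n → PState n I) (U : Set (Fin n)) :
    Fin n → Option (PState n I) :=
  fun j => if j ∈ U then some (s j) else none

theorem update_view {n : ℕ} {I : Type} (s : Fin n → PState n I) (U : Set (Fin n)) (i : Fin n) :
    Function.update (view s U) i (some (s i)) = view s (insert i U) := by
  funext j
  by_cases h : j = i
  · subst h
    simp [view]
  · by_cases hU : j ∈ U <;> simp [view, h, hU]

theorem stepc_of_not_hasUpd {n : ℕ} {I : Type} {C : Config n I} {i : Fin n}
    (h : (C.st i).hasUpd = false) :
    stepc C i =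
      { mem := Function.update C.mem (C.st i).rounds
          (Function.update (C.mem (C.st i).rounds) i (some (C.st i))),
        st := Function.update C.st i (PState.upd (C.st i)) } := by
  unfold stepc
  split
  · simp_all [PState.hasUpd]
  · rfl

theorem stepc_of_eq_upd {n : ℕ} {I : Type} {C : Config n I} {i : Fin n} {s : PState n I}
    (h : C.st i = PState.upd s) :
    stepc C i =
      { C with st := Function.update C.st i (PState.scanned i s.rounds (C.mem s.rounds)) } := by
  unfold stepc
  rw [h]

/-- The configurations reached from a configuration with process states `s` within a round on
the snapshot object with index `t` in which the processes in `A` take part: `D` is the current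
configuration, `l` the rest of the schedule, `U` the set of processes that have performed their
update, and `T i` the set of processes seen by the scan of process `i` (empty before it). -/
structure RoundInv {n : ℕ} {I : Type} (s : Fin n → PState n I) (A : Set (Fin n)) (t : ℕ)
    (D : Config n I) (l : List (Fin n)) (U : Set (Fin n)) (T : Fin n → Set (Fin n)) : Prop where
  mem_eq : D.mem t = view s U
  subset : U ⊆ A
  inactive : ∀ i ∉ A, D.st i = s i ∧ l.count i = 0
  active : ∀ i ∈ A,
    (l.count i = 2 ∧ D.st i = s i) ∨
    (l.count i = 1 ∧ i ∈ U ∧ D.st i = PState.upd (s i)) ∨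
    (l.count i = 0 ∧ i ∈ T i ∧ D.st i = PState.scanned i t (view s (T i)))
  seen_subset : ∀ i, T i ⊆ U
  chain : ∀ i j, T i ⊆ T j ∨ T j ⊆ T i

namespace RoundInv

variable {n : ℕ} {I : Type} {s : Fin n → PState n I} {A : Set (Fin n)} {t : ℕ}
  {D : Config n I} {l : List (Fin n)} {U : Set (Fin n)} {T : Fin n → Set (Fin n)} {i : Fin n}

theorem step_update (h : RoundInv s A t D (i :: l) U T) (hiA : i ∈ A)
    (hs : (s i).hasUpd = false ∧ (s i).rounds = t) (hc : (i :: l).count i = 2)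
    (hst : D.st i = s i) : RoundInv s A t (stepc D i) l (insert i U) T := by
  rw [stepc_of_not_hasUpd (hst ▸ hs.1), hst, hs.2]
  refine ⟨?_, Set.insert_subset hiA h.subset, fun j hj => ?_, fun j hj => ?_,
    fun j => (h.seen_subset j).trans (Set.subset_insert _ _), h.chain⟩
  · simp [h.mem_eq, update_view]
  · have hne : j ≠ i := fun e => hj (e ▸ hiA)
    simpa [hne, hne.symm] using h.inactive j hj
  · by_cases hne : j = i
    · subst hne
      simp_all
    · have := h.active j hj
      simp_all [Ne.symm hne]

theorem step_scan (h : RoundInv s A t D (i :: l) U T) (hiA : i ∈ A)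
    (hs : (s i).rounds = t) (hc : (i :: l).count i = 1) (hiU : i ∈ U)
    (hst : D.st i = PState.upd (s i)) :
    RoundInv s A t (stepc D i) l U (Function.update T i U) := by
  rw [stepc_of_eq_upd hst, hs]
  refine ⟨h.mem_eq, h.subset, fun j hj => ?_, fun j hj => ?_, fun j => ?_, fun j k => ?_⟩
  · have hne : j ≠ i := fun e => hj (e ▸ hiA)
    simpa [hne, hne.symm] using h.inactive j hj
  · by_cases hne : j = i
    · subst hne
      refine Or.inr (Or.inr ⟨by simpa using hc, by simpa using hiU, by simp [h.mem_eq]⟩)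
    · have := h.active j hj
      simp_all [Ne.symm hne]
  · by_cases hj : j = i
    · subst hj
      simp
    · simpa [hj] using h.seen_subset j
  · by_cases hj : j = i <;> by_cases hk : k = i
    · simp [hj, hk]
    · simp [hj, hk, h.seen_subset k]
    · simp [hj, hk, h.seen_subset j]
    · simpa [hj, hk] using h.chain j k

theorem runSched_nil (hs : ∀ i ∈ A, (s i).hasUpd = false ∧ (s i).rounds = t)
    (h : RoundInv s A t D l U T) : ∃ U' T', RoundInv s A t (runSched D l) [] U' T' := by
  induction l generalizing D U T with
  | nil => exact ⟨U, T, h⟩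
  | cons i l ih =>
    by_cases hiA : i ∈ A
    · rcases h.active i hiA with ⟨hc, hst⟩ | ⟨hc, hiU, hst⟩ | ⟨hc, -⟩
      · exact ih (h.step_update hiA (hs i hiA) hc hst)
      · exact ih (h.step_scan hiA (hs i hiA).2 hc hiU hst)
      · simp at hc
    · simpa using (h.inactive i hiA).2

end RoundInv

theorem embedSub_inr_image {n : ℕ} {I : Type} {s : Fin n → PState n I}
    (hs : ∀ i, (s i).pid = i) (t : ℕ) (i : Fin n) (T : Set (Fin n)) :
    embedSub t (Sum.inr (i, s '' T)) = PState.scanned i t (view s T) := by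
  simp only [embedSub, Sum.elim_inr, PState.scanned.injEq, true_and]
  funext j
  by_cases hj : j ∈ T
  · have hex : ∃ w ∈ s '' T, PState.pid w = j := ⟨s j, ⟨j, hj, rfl⟩, hs j⟩
    obtain ⟨⟨k, hk, hkw⟩, hpid⟩ := hex.choose_spec
    have hkj : k = j := by rw [← hs k, hkw, hpid]
    rw [dif_pos hex, ← hkw, hkj]
    simp [view, hj]
  · have hex : ¬ ∃ w ∈ s '' T, PState.pid w = j := by
      rintro ⟨_, ⟨k, hk, rfl⟩, rfl⟩
      exact hj (by rwa [hs k])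
    rw [dif_neg hex]
    simp [view, hj]

theorem isNClique_range {n : ℕ} {V : Type} {G : PGraph V} {idv : V → Fin n} {v : Fin n → V}
    (hid : ∀ i, idv (v i) = i) (hv : ∀ i, v i ∈ G.verts)
    (hadj : ∀ i j, i ≠ j → G.Adj (v i) (v j)) : IsNClique n G idv (Set.range v) := by
  have hinj : Function.Injective v := Function.LeftInverse.injective hid
  refine ⟨Set.range_subset_iff.2 hv, Set.finite_range v, ?_, ?_, ?_⟩
  · rw [← Set.image_univ, Set.ncard_image_of_injective _ hinj]
    simp
  · rintro _ ⟨i, rfl⟩ _ ⟨j, rfl⟩ hne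
    exact hadj i j fun e => hne (congrArg v e)
  · rintro _ ⟨i, rfl⟩ _ ⟨j, rfl⟩ he
    rw [hid, hid] at he
    rw [he]

/-- Let `σ` be an `n`-vertex clique that represents a
configuration `C` of an NIS protocol in which every active process is poised to
update the snapshot object `S_{t+1}` (here indexed by `t`, i.e. `C.mem t`). If
`β` is a 1-round schedule from `C`, then the configuration `Cβ` is represented
by an `n`-vertex clique of `χ(σ,δ)`. -/
theorem one_round_config_is_clique {n : ℕ} {I O : Type} (hn : 2 ≤ n)
    (δ : PState n I → Option O)
    (hδ : ∀ s : PState n I, δ s ≠ none → s.isScanned = true)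
    (σ : Set (PState n I)) (C : Config n I) (t : ℕ)
    (hrep : Represents σ C)
    (hpoised : ∀ i, δ (C.st i) = none → PoisedUpdate C i t)
    (hfresh : ∀ j, C.mem t j = none)
    (β : List (Fin n)) (hβ : IsOneRound δ C β) :
    ∃ κ : Set (SubV (PState n I) n),
      IsNClique n (chiCliqueGraph n δ PState.pid σ) (subId n PState.pid) κ ∧
        Represents (embedSub t '' κ) (runSched C β) := by
  classical
  obtain ⟨rfl, hpid⟩ := hrep
  let A : Set (Fin n) := {i | δ (C.st i) = none}
  have hinit : RoundInv C.st A t C β ∅ fun _ => ∅ :=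
    { mem_eq := by
        funext j
        simp [hfresh, view]
      subset := Set.empty_subset _
      inactive := fun i hi => ⟨rfl, by
        have hne : δ (C.st i) ≠ none := hi
        rw [hβ.2 i, if_neg (by simpa using hne)]⟩
      active := fun i hi => Or.inl ⟨by
        have hi' : δ (C.st i) = none := hi
        rw [hβ.2 i, hi']
        rfl, rfl⟩
      seen_subset := fun _ => le_rfl
      chain := fun _ _ => Or.inl le_rfl }
  obtain ⟨U, T, h⟩ := hinit.runSched_nil hpoised
  have hfin : ∀ i ∈ A, i ∈ T i ∧
      (runSched C β).st i = PState.scanned i t (view C.st (T i)) := fun i hi => by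
    simpa using h.active i hi
  let v : Fin n → SubV (PState n I) n := fun i =>
    if i ∈ A then Sum.inr (i, C.st '' T i) else Sum.inl (C.st i)
  have hvA : ∀ i ∈ A, v i = Sum.inr (i, C.st '' T i) := fun i hi => if_pos hi
  have hvN : ∀ i ∉ A, v i = Sum.inl (C.st i) := fun i hi => if_neg hi
  have hid : ∀ i, subId n PState.pid (v i) = i := fun i => by
    by_cases hi : i ∈ A
    · rw [hvA i hi, subId]
    · rw [hvN i hi, subId, hpid]
  have hverts : ∀ i, v i ∈ chiVerts n δ PState.pid (Set.range C.st) := fun i => by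
    by_cases hi : i ∈ A
    · refine Or.inr ⟨i, C.st '' T i, ?_, ⟨C.st i, ⟨i, (hfin i hi).1, rfl⟩, hpid i⟩, hvA i hi⟩
      rintro _ ⟨j, hj, rfl⟩
      exact ⟨⟨j, rfl⟩, h.subset (h.seen_subset i hj)⟩
    · exact Or.inl ⟨C.st i, ⟨i, rfl⟩, hi, hvN i hi⟩
  have hemb : ∀ i, embedSub t (v i) = (runSched C β).st i := fun i => by
    by_cases hi : i ∈ A
    · rw [hvA i hi, embedSub_inr_image hpid, (hfin i hi).2]
    · rw [hvN i hi, (h.inactive i hi).1]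
      rfl
  refine ⟨Set.range v, isNClique_range hid hverts fun i j hij =>
    ⟨hverts i, hverts j, by rwa [hid, hid], ?_⟩, ?_, fun i => ?_⟩
  · by_cases hi : i ∈ A
    · by_cases hj : j ∈ A
      · exact Or.inr (Or.inr ⟨i, _, j, _, hvA i hi, hvA j hj,
          (h.chain i j).imp (Set.image_mono ·) (Set.image_mono ·)⟩)
      · exact Or.inr (Or.inl ⟨_, hvN j hj⟩)
    · exact Or.inl ⟨_, hvN i hi⟩
  · rw [← Set.range_comp]
    exact congrArg Set.range (funext hemb)
  · by_cases hi : i ∈ A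
    · rw [(hfin i hi).2, PState.pid]
    · rw [(h.inactive i hi).1, hpid]

end EBP
end

section
/- Let G be a union of n-vertex cliques with status function δ, and let u be an active vertex of G such that every n-vertex clique of G containing u consists entirely of active vertices. Then v := (id(u), {u}) is a vertex of χ(G,δ), every vertex adjacent to v in χ(G,δ) is active and has the form (j, ρ) with u ∈ ρ, and, for every terminated vertex w of G (which is also a vertex of χ(G,δ)), the distance between v and w in χ(G,δ) is at least 3. -/
set_option linter.dupNamespace false

namespace EBP

variable {V O : Type}

theorem mem_chiVerts_inl {n : ℕ} {δ : V → Option O} {idv : V → Fin n} {σ : Set V} {w : V} :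
    (Sum.inl w : SubV V n) ∈ chiVerts n δ idv σ ↔ w ∈ σ ∧ δ w ≠ none := by
  simp [chiVerts]

theorem mem_chiVerts_inr {n : ℕ} {δ : V → Option O} {idv : V → Fin n} {σ : Set V}
    {i : Fin n} {τ : Set V} :
    (Sum.inr (i, τ) : SubV V n) ∈ chiVerts n δ idv σ ↔
      τ ⊆ {v ∈ σ | δ v = none} ∧ ∃ w ∈ τ, idv w = i := by
  constructor
  · rintro (⟨v, _, _, h⟩ | ⟨i', τ', hτ, hw, h⟩)
    · cases h
    · cases h
      exact ⟨hτ, hw⟩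
  · rintro ⟨hτ, hw⟩
    exact Or.inr ⟨i, τ, hτ, hw, rfl⟩

/-- If all `n`-vertex cliques through `u` are active, then a vertex `(j, ρ)` with `u ∈ ρ` is
not adjacent to a terminated vertex. -/
theorem not_adj_inl_of_mem {n : ℕ} {G : PGraph V} {idv : V → Fin n} {δ : V → Option O} {u : V}
    (hcl : ∀ σ, IsNClique n G idv σ → u ∈ σ → ∀ w ∈ σ, δ w = none)
    {j : Fin n} {ρ : Set V} (hρ : u ∈ ρ) (w : V) :
    ¬ (chiGraph n G δ idv).Adj (Sum.inr (j, ρ)) (Sum.inl w) := by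
  rintro ⟨σ, hσ, hx, hy, -⟩
  rw [mem_chiVerts_inr] at hx
  rw [mem_chiVerts_inl] at hy
  exact hy.2 (hcl σ hσ (hx.1 hρ).1 w hy.1)

/-- If all `n`-vertex cliques through `u` are active, then every neighbour of `(i, {u})` has the
form `(j, ρ)` with `u ∈ ρ`. -/
theorem exists_eq_inr_of_adj_singleton {n : ℕ} {G : PGraph V} {idv : V → Fin n}
    {δ : V → Option O} {u : V}
    (hcl : ∀ σ, IsNClique n G idv σ → u ∈ σ → ∀ w ∈ σ, δ w = none)
    {i : Fin n} {y : SubV V n} (h : (chiGraph n G δ idv).Adj (Sum.inr (i, {u})) y) :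
    ∃ j ρ, y = Sum.inr (j, ρ) ∧ u ∈ ρ := by
  rcases y with w | ⟨j, ρ⟩
  · exact absurd h (not_adj_inl_of_mem hcl (Set.mem_singleton u) w)
  · refine ⟨j, ρ, rfl, ?_⟩
    obtain ⟨σ, -, -, hy, -, ⟨_, h⟩ | ⟨_, h⟩ | ⟨i', τ, j', ρ', hx, hy', hs⟩⟩ := h
    · cases h
    · cases h
    · cases hx
      cases hy'
      obtain ⟨-, v, hv, -⟩ := mem_chiVerts_inr.1 hy
      rcases hs with hs | hs
      · exact hs rfl
      · exact Set.mem_singleton_iff.1 (hs hv) ▸ hv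

/-- If every walk from `A` to `B` has more than `k` vertices, then the distance between `A` and
`B` is at least `k`. -/
theorem le_setDist {W : Type} {H : PGraph W} {A B : Set W} {k : ℕ}
    (h : ∀ l, IsWalkBetween H A B l → k < l.length) : (k : ℕ∞) ≤ setDist H A B := by
  refine le_sInf ?_
  rintro d ⟨l, hl, hd⟩
  have hk := h l hl
  induction d using ENat.recTopCoe with
  | top => exact le_top
  | coe d =>
    norm_cast at hd ⊢
    omega

/-- Let `G` be a union of `n`-vertex cliques with status
function `δ`, and let `u` be an active vertex of `G` such that every `n`-vertex
clique of `G` containing `u` consists entirely of active vertices. Then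
`v := (id(u), {u})` is a vertex of `χ(G,δ)`, every vertex adjacent to `v` in
`χ(G,δ)` is active and has the form `(j, ρ)` with `u ∈ ρ`, and, for every
terminated vertex `w` of `G`, the distance between `v` and `w` in `χ(G,δ)` is
at least 3. -/
theorem lonely_active_vertex {V O : Type} (n : ℕ) (hn : 2 ≤ n)
    (G : PGraph V) (idv : V → Fin n) (δ : V → Option O)
    (hG : IsCliqueUnionGraph n G idv)
    (u : V) (hu : u ∈ G.verts) (hact : δ u = none)
    (hcl : ∀ σ, IsNClique n G idv σ → u ∈ σ → ∀ w ∈ σ, δ w = none) :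
    (Sum.inr (idv u, {u}) : SubV V n) ∈ (chiGraph n G δ idv).verts ∧
      (∀ y, (chiGraph n G δ idv).Adj (Sum.inr (idv u, {u})) y →
        subStatus n δ y = none ∧ ∃ j ρ, y = Sum.inr (j, ρ) ∧ u ∈ ρ) ∧
      (∀ w, w ∈ G.verts → δ w ≠ none →
        3 ≤ setDist (chiGraph n G δ idv)
          ({Sum.inr (idv u, {u})} : Set (SubV V n))
          ({Sum.inl w} : Set (SubV V n))) := by
  refine ⟨?_, fun y hy => ?_, fun w _ _ => ?_⟩
  · obtain ⟨σ, hσ, huσ⟩ := hG.1 u hu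
    refine ⟨σ, hσ, mem_chiVerts_inr.2 ⟨?_, u, rfl, rfl⟩⟩
    rintro _ rfl
    exact ⟨huσ, hact⟩
  · obtain ⟨j, ρ, rfl, hρ⟩ := exists_eq_inr_of_adj_singleton hcl hy
    exact ⟨rfl, j, ρ, rfl, hρ⟩
  · refine le_setDist (k := 3) ?_
    rintro l ⟨hchain, -, hne, hhead, hlast⟩
    rcases l with _ | ⟨a, _ | ⟨b, _ | ⟨c, _ | ⟨d, l⟩⟩⟩⟩
    · exact absurd rfl hne
    · simp only [List.head_cons, List.getLast_singleton, Set.mem_singleton_iff] at hhead hlast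
      exact absurd (hhead.symm.trans hlast) Sum.inr_ne_inl
    · obtain rfl : a = _ := hhead
      obtain rfl : b = _ := hlast
      exact absurd (List.isChain_cons_cons.1 hchain).1 (not_adj_inl_of_mem hcl (Set.mem_singleton u) w)
    · obtain rfl : a = _ := hhead
      obtain rfl : c = _ := hlast
      obtain ⟨hab, hbc⟩ := List.isChain_cons_cons.1 hchain
      obtain ⟨j, ρ, rfl, hρ⟩ := exists_eq_inr_of_adj_singleton hcl hab
      exact absurd (List.isChain_cons_cons.1 hbc).1 (not_adj_inl_of_mem hcl hρ w)
    · simp only [List.length_cons]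
      omega

end EBP
end
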